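/- arXiv:2011.12233 — 7 statements merged into one kernel-verified Lean document; each statement's English description precedes it below -/
import Mathlib

section
/- Suppose for each i ∈ {1,…,n} there are functions x_i, y_i, z_i : [0,∞) → ℝ^d such that: z_i(t) = ∇φ(x_i(t)) for all t ≥ 0; each x_i is continuous; y_i(0) = 0; for every t ≥ 0, y_i has derivative Σ_{j ∈ N_i}(x_i(t) − x_j(t)) at t, and z_i has derivative −(∇f_i(x_i(t)) + Σ_{j ∈ N_i}(x_i(t) − x_j(t)) + y_i(t)) at t. Then for every i ∈ {1,…,n}, x_i(t) converges to x* as t → ∞. -/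
open scoped BigOperators

section SaddleFlow

open Set Filter Topology InnerProductSpace

/-- First-order characterization of convexity: a differentiable convex function lies above its
tangent hyperplanes. -/
theorem ConvexOn.add_inner_gradient_le {E : Type*} [NormedAddCommGroup E] [InnerProductSpace ℝ E]
    [CompleteSpace E] {f : E → ℝ} (hf : ConvexOn ℝ univ f) {g x : E} (hg : HasGradientAt f g x)
    (w : E) : f x + inner ℝ g (w - x) ≤ f w := by
  let ℓ : ℝ →ᵃ[ℝ] E := AffineMap.lineMap x w
  have hconv : ConvexOn ℝ univ (f ∘ ℓ) := by simpa using hf.comp_affineMap ℓ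
  have hℓ : HasDerivAt ℓ (w - x) 0 := by
    simpa [ℓ] using AffineMap.hasDerivAt_lineMap (a := x) (b := w) (x := (0 : ℝ))
  have hx : HasFDerivAt f (toDual ℝ E g) (ℓ 0) := by simpa [ℓ] using hg.hasFDerivAt
  have hd : HasDerivAt (f ∘ ℓ) (inner ℝ g (w - x)) 0 := by
    simpa using hx.comp_hasDerivAt 0 hℓ
  have := hconv.le_slope_of_hasDerivAt (mem_univ 0) (mem_univ 1) one_pos hd
  simp [slope_def_field, ℓ] at this
  linarith

/-- First-order characterization of `μ`-strong convexity. -/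
theorem ConvexOn.add_inner_gradient_add_sq_le {E : Type*} [NormedAddCommGroup E]
    [InnerProductSpace ℝ E] [CompleteSpace E] {φ : E → ℝ} {μ : ℝ}
    (hφ : ConvexOn ℝ univ fun x => φ x - μ / 2 * ‖x‖ ^ 2) {g x : E} (hg : HasGradientAt φ g x)
    (w : E) : φ x + inner ℝ g (w - x) + μ / 2 * ‖w - x‖ ^ 2 ≤ φ w := by
  have hsq : HasGradientAt (fun x : E => φ x - μ / 2 * ‖x‖ ^ 2) (g - μ • x) x := by
    rw [hasGradientAt_iff_hasFDerivAt]
    refine (hg.hasFDerivAt.sub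
      ((hasStrictFDerivAt_norm_sq x).hasFDerivAt.const_mul (μ / 2))).congr_fderiv ?_
    ext v
    simp
    ring
  have h := hφ.add_inner_gradient_le hsq w
  simp only [inner_sub_left, inner_sub_right, real_inner_smul_left,
    real_inner_self_eq_norm_sq] at h
  rw [norm_sub_sq_real, inner_sub_right, real_inner_comm x w]
  linarith

variable {H : Type*} [NormedAddCommGroup H] [InnerProductSpace ℝ H]

/-- For a positive symmetric bounded operator, the quadratic form controls the norm of the
image. -/
theorem ContinuousLinearMap.norm_apply_sq_le_of_symm_of_nonneg (L : H →L[ℝ] H)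
    (hsymm : ∀ u v, inner ℝ (L u) v = inner ℝ u (L v)) (hpos : ∀ u, 0 ≤ inner ℝ (L u) u) (w : H) :
    ‖L w‖ ^ 2 ≤ (‖L‖ + 1) * inner ℝ (L w) w := by
  have hC : 0 < ‖L‖ + 1 := by positivity
  have h := hpos (w - (‖L‖ + 1)⁻¹ • L w)
  have hb : inner ℝ (L (L w)) (L w) ≤ (‖L‖ + 1) * ‖L w‖ ^ 2 := by
    refine (real_inner_le_norm _ _).trans ?_
    nlinarith [L.le_opNorm (L w), norm_nonneg (L w), sq_nonneg ‖L w‖]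
  simp only [map_sub, map_smul, inner_sub_left, inner_sub_right, real_inner_smul_left,
    real_inner_smul_right] at h
  rw [hsymm (L w) w, real_inner_self_eq_norm_sq] at h
  have h2 : (‖L‖ + 1)⁻¹ * ((‖L‖ + 1)⁻¹ * inner ℝ (L (L w)) (L w))
      ≤ (‖L‖ + 1)⁻¹ * ‖L w‖ ^ 2 := by
    refine mul_le_mul_of_nonneg_left ?_ (by positivity)
    rw [inv_mul_le_iff₀ hC]
    exact hb
  have h3 : (‖L‖ + 1)⁻¹ * ‖L w‖ ^ 2 ≤ inner ℝ (L w) w := by linarith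
  rwa [inv_mul_le_iff₀ hC] at h3

/-- If `z t` is a subgradient of `Φ` at `x t`, then the conjugate value `⟪z, x⟫ - Φ x` is
differentiable along the curve as soon as `z` is differentiable and `x` is continuous. -/
theorem hasDerivWithinAt_inner_sub_of_subgradient {Φ : H → ℝ} {x z : ℝ → H} {s : Set ℝ}
    (hsub : ∀ t ∈ s, ∀ w, Φ (x t) + inner ℝ (z t) (w - x t) ≤ Φ w) {t : ℝ} (ht : t ∈ s) {z' : H}
    (hx : ContinuousWithinAt x s t) (hz : HasDerivWithinAt z z' s t) :
    HasDerivWithinAt (fun r => inner ℝ (z r) (x r) - Φ (x r)) (inner ℝ z' (x t)) s t := by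
  have hlin : HasDerivWithinAt (fun r => inner ℝ (z r) (x t)) (inner ℝ z' (x t)) s t := by
    simpa using hz.inner ℝ (hasDerivWithinAt_const t s (x t))
  have hrem : HasDerivWithinAt
      (fun r => inner ℝ (z r) (x r) - Φ (x r) - inner ℝ (z r) (x t)) 0 s t := by
    rw [hasDerivWithinAt_iff_isLittleO]
    have hx0 : (fun r => x r - x t) =o[𝓝[s] t] (fun _ => (1 : ℝ)) := by
      rw [Asymptotics.isLittleO_one_iff]
      exact tendsto_sub_nhds_zero_iff.2 hx
    have hprod := hz.hasFDerivWithinAt.isBigO_sub.norm_left.mul_isLittleO hx0.norm_left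
    simp only [mul_one] at hprod
    refine Asymptotics.IsBigO.trans_isLittleO (.of_bound 1 ?_) hprod
    filter_upwards [self_mem_nhdsWithin] with r hr
    have h1 := hsub t ht (x r)
    have h2 := hsub r hr (x t)
    have h3 := real_inner_le_norm (z r - z t) (x r - x t)
    have h4 : 0 ≤ ‖z r - z t‖ * ‖x r - x t‖ := by positivity
    simp only [inner_sub_right, inner_sub_left] at h1 h2 h3
    rw [smul_zero, sub_zero, one_mul, Real.norm_eq_abs, Real.norm_eq_abs, abs_of_nonneg h4,
      abs_le]
    constructor <;> linarith
  exact (hlin.add hrem).congr_deriv (by simp) |>.congr (fun r _ => by simp) (by simp [sub_eq_add_neg])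

/-- A Lipschitz bounded curve along which a nonnegative function decreases at a rate bounded
below by a continuous function vanishing only at `p` converges to `p`. -/
theorem tendsto_of_hasDerivWithinAt_le_neg [FiniteDimensional ℝ H] {x : ℝ → H} {p : H} {C R : ℝ}
    {V V' : ℝ → ℝ} {Q : H → ℝ}
    (hlip : ∀ s ∈ Ici (0 : ℝ), ∀ t ∈ Ici (0 : ℝ), ‖x t - x s‖ ≤ C * |t - s|)
    (hbdd : ∀ t ∈ Ici (0 : ℝ), ‖x t - p‖ ≤ R)
    (hV : ∀ t ∈ Ici (0 : ℝ), HasDerivWithinAt V (V' t) (Ici 0) t)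
    (hV' : ∀ t ∈ Ici (0 : ℝ), V' t ≤ -Q (x t)) (hV0 : ∀ t ∈ Ici (0 : ℝ), 0 ≤ V t)
    (hQ : Continuous Q) (hQ0 : ∀ u, 0 ≤ Q u) (hQp : ∀ u, Q u = 0 → u = p) :
    Tendsto x atTop (𝓝 p) := by
  have hdrop : ∀ a ∈ Ici (0 : ℝ), ∀ b, a ≤ b → ∀ c, (∀ r ∈ Icc a b, c ≤ Q (x r)) →
      V b + c * (b - a) ≤ V a := by
    intro a ha b hab c hc
    have hsub : Icc a b ⊆ Ici (0 : ℝ) := fun r hr => le_trans ha hr.1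
    have hd : ∀ r ∈ Icc a b, HasDerivWithinAt (fun r => V r + c * (r - a)) (V' r + c) (Icc a b) r :=
      fun r hr => by
        exact (((hV r (hsub hr)).mono hsub).add
          (((hasDerivWithinAt_id r _).sub_const a).const_mul c)).congr_deriv (by simp)
    have hanti : AntitoneOn (fun r => V r + c * (r - a)) (Icc a b) :=
      antitoneOn_of_hasDerivWithinAt_nonpos (convex_Icc a b)
        (fun r hr => (hd r hr).continuousWithinAt)
        (fun r hr => (hd r (interior_subset hr)).mono interior_subset)
        (fun r hr => by
          have := hV' r (hsub (interior_subset hr))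
          have := hc r (interior_subset hr)
          linarith)
    simpa using hanti (left_mem_Icc.2 hab) (right_mem_Icc.2 hab) hab
  rw [Metric.tendsto_atTop]
  by_contra! hcon
  obtain ⟨ε, hε, hfar⟩ := hcon
  set K : Set H := {u | ε / 2 ≤ ‖u - p‖ ∧ ‖u - p‖ ≤ R} with hKdef
  have hK : IsCompact K := by
    refine (isCompact_closedBall p R).of_isClosed_subset
      ((isClosed_le (by fun_prop : Continuous fun _ : H => ε / 2) (by fun_prop)).inter
        (isClosed_le (by fun_prop) (by fun_prop : Continuous fun _ : H => R))) ?_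
    intro u hu
    simpa [dist_eq_norm] using hu.2
  have hKne : K.Nonempty := by
    obtain ⟨t, ht, htε⟩ := hfar 0
    rw [dist_eq_norm] at htε
    exact ⟨x t, by linarith, hbdd t ht⟩
  obtain ⟨u, huK, humin⟩ := hK.exists_isMinOn hKne hQ.continuousOn
  have hc : 0 < Q u := by
    refine lt_of_le_of_ne (hQ0 u) fun h => ?_
    have := huK.1
    rw [hQp u h.symm, sub_self, norm_zero] at this
    linarith
  set δ : ℝ := ε / (2 * (|C| + 1)) with hδdef
  have hδ : 0 < δ := by positivity
  have hCδ : |C| * δ ≤ ε / 2 := by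
    rw [hδdef, mul_div_assoc', div_le_div_iff₀ (by positivity) two_pos]
    nlinarith [abs_nonneg C]
  have hbelow : BddBelow (V '' Ici 0) := ⟨0, by rintro _ ⟨t, ht, rfl⟩; exact hV0 t ht⟩
  obtain ⟨_, ⟨t₀, ht₀, rfl⟩, hlt⟩ := exists_lt_of_csInf_lt (s := V '' Ici 0)
    ⟨_, 0, self_mem_Ici, rfl⟩ (lt_add_of_pos_right (sInf (V '' Ici 0)) (mul_pos hc hδ))
  obtain ⟨t, htt, htε⟩ := hfar t₀
  have ht : t ∈ Ici (0 : ℝ) := le_trans ht₀ htt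
  rw [dist_eq_norm] at htε
  have h1 := hdrop t₀ ht₀ t htt 0 fun r _ => hQ0 _
  have h2 := hdrop t ht (t + δ) (by linarith) (Q u) fun r hr => by
    have hr0 : r ∈ Ici (0 : ℝ) := le_trans ht hr.1
    refine humin ⟨?_, hbdd r hr0⟩
    have h3 := hlip r hr0 t ht
    have h4 : |t - r| ≤ δ := by rw [abs_le]; constructor <;> linarith [hr.1, hr.2]
    have h5 : C * |t - r| ≤ |C| * δ := mul_le_mul (le_abs_self C) h4 (abs_nonneg _) (abs_nonneg _)
    have h6 := norm_sub_le_norm_sub_add_norm_sub (x t) (x r) p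
    linarith
  have h3 := csInf_le hbelow ⟨t + δ, by simp only [mem_Ici] at ht ⊢; linarith, rfl⟩
  nlinarith

/-- A curve that is continuous on `[0, ∞)` has a primitive there. -/
theorem exists_primitive_Ici [CompleteSpace H] {x : ℝ → H} (hx : ContinuousOn x (Ici 0)) :
    ∃ v : ℝ → H, v 0 = 0 ∧ ∀ t ∈ Ici (0 : ℝ), HasDerivWithinAt v (x t) (Ici 0) t := by
  have hc : Continuous fun s : ℝ => x (max s 0) :=
    hx.comp_continuous (by fun_prop) fun s => le_max_right s 0
  refine ⟨fun t => ∫ s in (0 : ℝ)..t, x (max s 0), by simp, fun t ht => ?_⟩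
  have h := (hc.integral_hasStrictDerivAt 0 t).hasDerivAt.hasDerivWithinAt (s := Ici 0)
  rwa [max_eq_left ht] at h

/-- Subgradients along a bounded curve of a continuous function are bounded. -/
theorem exists_norm_subgradient_le [FiniteDimensional ℝ H] {F : H → ℝ} (hF : Continuous F)
    (p : H) (R : ℝ) :
    ∃ M, ∀ u g : H, ‖u - p‖ ≤ R → (∀ w, F u + inner ℝ g (w - u) ≤ F w) → ‖g‖ ≤ M := by
  obtain ⟨M, hM⟩ := (isCompact_closedBall p (R + 1)).exists_bound_of_continuousOn hF.continuousOn
  refine ⟨M + M, fun u g hu hg => ?_⟩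
  have hn : ‖‖g‖⁻¹ • g‖ ≤ 1 := by
    rw [norm_smul, norm_inv, norm_norm]
    exact inv_mul_le_one
  have h1 := hM u (by rw [mem_closedBall_iff_norm]; linarith)
  have h2 := hM (u + ‖g‖⁻¹ • g) (by
    rw [mem_closedBall_iff_norm, add_sub_right_comm]
    exact (norm_add_le _ _).trans (add_le_add hu hn))
  have h3 := hg (u + ‖g‖⁻¹ • g)
  rw [add_sub_cancel_left, real_inner_smul_right, real_inner_self_eq_norm_sq, pow_two] at h3
  have h4 : ‖g‖⁻¹ * (‖g‖ * ‖g‖) = ‖g‖ := by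
    rcases eq_or_ne ‖g‖ 0 with h | h
    · simp [h]
    · field_simp
  rw [h4] at h3
  rw [Real.norm_eq_abs, abs_le] at h1 h2
  linarith

/-- Convergence of the mirror-descent saddle-point flow for minimizing a convex function over the
kernel of a positive symmetric operator, phrased with subgradients. -/
theorem tendsto_mirror_saddle_flow [FiniteDimensional ℝ H] (L : H →L[ℝ] H)
    (hsymm : ∀ u v, inner ℝ (L u) v = inner ℝ u (L v)) (hpos : ∀ u, 0 ≤ inner ℝ (L u) u)
    {F Φ : H → ℝ} (hF : Continuous F) {μ : ℝ} (hμ : 0 < μ) {x y z g : ℝ → H} {p v₀ : H}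
    (hgF : ∀ t ∈ Ici (0 : ℝ), ∀ w, F (x t) + inner ℝ (g t) (w - x t) ≤ F w) (hp : L p = 0)
    (hFp : ∀ w, F p - inner ℝ (L v₀) (w - p) ≤ F w) (huniq : ∀ w, L w = 0 → F w = F p → w = p)
    (hΦ : ∀ t ∈ Ici (0 : ℝ), ∀ w,
      Φ (x t) + inner ℝ (z t) (w - x t) + μ / 2 * ‖w - x t‖ ^ 2 ≤ Φ w)
    (hx : ContinuousOn x (Ici 0)) (hy0 : y 0 = 0)
    (hy : ∀ t ∈ Ici (0 : ℝ), HasDerivWithinAt y (L (x t)) (Ici 0) t)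
    (hz : ∀ t ∈ Ici (0 : ℝ), HasDerivWithinAt z (-(g t + L (x t) + y t)) (Ici 0) t) :
    Tendsto x atTop (𝓝 p) := by
  obtain ⟨v, hv0, hv⟩ := exists_primitive_Ici hx
  have hLv : ∀ t ∈ Ici (0 : ℝ), HasDerivWithinAt (fun t => L (v t)) (L (x t)) (Ici 0) t :=
    fun t ht => L.hasFDerivAt.comp_hasDerivWithinAt t (hv t ht)
  have hyv : ∀ t ∈ Ici (0 : ℝ), y t = L (v t) := by
    intro t ht
    have h := (convex_Ici (0 : ℝ)).norm_image_sub_le_of_norm_hasDerivWithin_le (C := 0)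
      (fun r hr => (hy r hr).sub (hLv r hr)) (fun r _ => by simp) self_mem_Ici ht
    simpa [hy0, hv0, sub_eq_zero] using h
  set w : ℝ → H := fun t => v t - v₀ with hw
  have hyw : ∀ t ∈ Ici (0 : ℝ), y t = L (w t) + L v₀ := fun t ht => by
    rw [hyv t ht, hw, map_sub, sub_add_cancel]
  have hwd : ∀ t ∈ Ici (0 : ℝ), HasDerivWithinAt w (x t) (Ici 0) t :=
    fun t ht => (hv t ht).sub_const v₀
  have hLwd : ∀ t ∈ Ici (0 : ℝ), HasDerivWithinAt (fun t => L (w t)) (L (x t)) (Ici 0) t :=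
    fun t ht => L.hasFDerivAt.comp_hasDerivWithinAt t (hwd t ht)
  have hLp : ∀ u, inner ℝ (L u) p = 0 := fun u => by rw [hsymm, hp, inner_zero_right]
  have hΦ' : ∀ t ∈ Ici (0 : ℝ), ∀ w, Φ (x t) + inner ℝ (z t) (w - x t) ≤ Φ w := fun t ht w => by
    have := hΦ t ht w
    have : 0 ≤ μ / 2 * ‖w - x t‖ ^ 2 := by positivity
    linarith
  set V : ℝ → ℝ := fun t => (inner ℝ (z t) (x t) - Φ (x t)) - inner ℝ (z t) p + Φ p
    + 1 / 2 * inner ℝ (L (w t)) (w t) with hVdef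
  set V' : ℝ → ℝ := fun t => inner ℝ (-(g t + L (x t) + y t)) (x t)
    - inner ℝ (-(g t + L (x t) + y t)) p + inner ℝ (L (w t)) (x t) with hV'def
  set Q : H → ℝ := fun u => F u - F p + inner ℝ (L v₀) (u - p) + inner ℝ (L u) u with hQdef
  have hV : ∀ t ∈ Ici (0 : ℝ), HasDerivWithinAt V (V' t) (Ici 0) t := by
    intro t ht
    have h1 := hasDerivWithinAt_inner_sub_of_subgradient hΦ' ht (hx t ht) (hz t ht)
    have h2 := (hz t ht).inner ℝ (hasDerivWithinAt_const t (Ici 0) p)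
    have h3 := ((hLwd t ht).inner ℝ (hwd t ht)).const_mul (1 / 2 : ℝ)
    refine (((h1.sub h2).add_const (Φ p)).add h3).congr_deriv ?_
    rw [inner_zero_right, zero_add, hsymm (x t), real_inner_comm (L (w t)) (x t)]
    simp only [hV'def]
    ring
  have hV' : ∀ t ∈ Ici (0 : ℝ), V' t ≤ -Q (x t) := by
    intro t ht
    have h := hgF t ht p
    simp only [hV'def, hQdef, hyw t ht, inner_neg_left, inner_add_left, inner_sub_right, hLp] at h ⊢
    linarith
  have hQ0 : ∀ u, 0 ≤ Q u := fun u => by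
    have := hFp u
    have := hpos u
    simp only [hQdef]
    linarith
  have hVlow : ∀ t ∈ Ici (0 : ℝ),
      μ / 2 * ‖x t - p‖ ^ 2 + 1 / 2 * inner ℝ (L (w t)) (w t) ≤ V t := fun t ht => by
    have h := hΦ t ht p
    rw [norm_sub_rev, inner_sub_right] at h
    simp only [hVdef]
    linarith
  have hVle : ∀ t ∈ Ici (0 : ℝ), V t ≤ V 0 := fun t ht =>
    antitoneOn_of_hasDerivWithinAt_nonpos (convex_Ici 0)
      (fun r hr => (hV r hr).continuousWithinAt)
      (fun r hr => (hV r (interior_subset hr)).mono interior_subset)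
      (fun r hr => (hV' r (interior_subset hr)).trans (neg_nonpos.2 (hQ0 _))) self_mem_Ici ht ht
  have hbdd : ∀ t ∈ Ici (0 : ℝ), ‖x t - p‖ ≤ √(2 * V 0 / μ) := fun t ht => by
    refine Real.le_sqrt_of_sq_le ?_
    rw [le_div_iff₀ hμ]
    linarith [hVlow t ht, hVle t ht, hpos (w t)]
  have hLw : ∀ t ∈ Ici (0 : ℝ), ‖L (w t)‖ ≤ √((‖L‖ + 1) * (2 * V 0)) := fun t ht => by
    refine Real.le_sqrt_of_sq_le ((L.norm_apply_sq_le_of_symm_of_nonneg hsymm hpos _).trans ?_)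
    have : 0 ≤ μ / 2 * ‖x t - p‖ ^ 2 := by positivity
    gcongr
    linarith [hVlow t ht, hVle t ht]
  obtain ⟨M, hM⟩ := exists_norm_subgradient_le hF p √(2 * V 0 / μ)
  set C : ℝ := M + ‖L‖ * √(2 * V 0 / μ) + (√((‖L‖ + 1) * (2 * V 0)) + ‖L v₀‖) with hC
  have hzC : ∀ t ∈ Ici (0 : ℝ), ‖-(g t + L (x t) + y t)‖ ≤ C := fun t ht => by
    have h1 : ‖L (x t)‖ ≤ ‖L‖ * √(2 * V 0 / μ) := by
      have := L.le_opNorm_of_le (hbdd t ht)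
      rwa [map_sub, hp, sub_zero] at this
    have h2 : ‖y t‖ ≤ √((‖L‖ + 1) * (2 * V 0)) + ‖L v₀‖ := by
      rw [hyw t ht]
      exact norm_add_le_of_le (hLw t ht) le_rfl
    rw [norm_neg]
    exact norm_add_le_of_le (norm_add_le_of_le (hM _ _ (hbdd t ht) (hgF t ht)) h1) h2
  have hlip : ∀ s ∈ Ici (0 : ℝ), ∀ t ∈ Ici (0 : ℝ), ‖x t - x s‖ ≤ C / μ * |t - s| := by
    intro s hs t ht
    have h1 := (convex_Ici (0 : ℝ)).norm_image_sub_le_of_norm_hasDerivWithin_le hz hzC hs ht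
    rw [Real.norm_eq_abs] at h1
    have h2 := hΦ t ht (x s)
    have h3 := hΦ s hs (x t)
    have h4 := real_inner_le_norm (z t - z s) (x t - x s)
    rw [norm_sub_rev] at h2
    simp only [inner_sub_left, inner_sub_right] at h2 h3 h4
    have h5 : μ * ‖x t - x s‖ ^ 2 ≤ C * |t - s| * ‖x t - x s‖ := by
      have := mul_le_mul_of_nonneg_right h1 (norm_nonneg (x t - x s))
      linarith
    rw [div_mul_eq_mul_div, le_div_iff₀ hμ]
    rcases (norm_nonneg (x t - x s)).eq_or_lt with h | h
    · rw [← h, zero_mul]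
      exact (norm_nonneg _).trans h1
    · nlinarith
  refine tendsto_of_hasDerivWithinAt_le_neg hlip hbdd hV hV' (fun t ht => ?_) ?_ hQ0 fun u hu => ?_
  · have := hpos (w t)
    exact le_trans (by positivity) (hVlow t ht)
  · fun_prop
  · have h1 := hFp u
    have h2 := hpos u
    simp only [hQdef] at hu
    have h3 : inner ℝ (L u) u = 0 := by linarith
    have h4 : L u = 0 := by
      have h := L.norm_apply_sq_le_of_symm_of_nonneg hsymm hpos u
      rw [h3, mul_zero] at h
      exact norm_eq_zero.1 (pow_eq_zero_iff two_ne_zero |>.1 (le_antisymm h (sq_nonneg _)))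
    refine huniq u h4 ?_
    rw [hsymm, map_sub, h4, hp, sub_zero, inner_zero_right, inner_zero_left] at hu
    linarith

namespace SimpleGraph

variable {V E : Type*} [Fintype V] [NormedAddCommGroup E] [InnerProductSpace ℝ E]
  (G : SimpleGraph V) [DecidableRel G.Adj]

/-- The graph Laplacian acting on `E`-valued functions on the vertices. -/
noncomputable def vectorLaplacian :
    PiLp 2 (fun _ : V => E) →ₗ[ℝ] PiLp 2 (fun _ : V => E) where
  toFun u := WithLp.toLp 2 fun i => ∑ j ∈ G.neighborFinset i, (u i - u j)
  map_add' u v := by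
    ext i
    simp only [PiLp.add_apply, ← Finset.sum_add_distrib]
    exact Finset.sum_congr rfl fun _ _ => by abel
  map_smul' c u := by
    ext i
    simp only [PiLp.smul_apply, RingHom.id_apply, Finset.smul_sum, smul_sub]

@[simp]
theorem vectorLaplacian_apply (u : PiLp 2 (fun _ : V => E)) (i : V) :
    G.vectorLaplacian u i = ∑ j ∈ G.neighborFinset i, (u i - u j) := rfl

/-- The quadratic form of the Laplacian as a sum over ordered pairs of adjacent vertices. -/
theorem two_mul_inner_vectorLaplacian (u v : PiLp 2 (fun _ : V => E)) :
    2 * inner ℝ (G.vectorLaplacian u) v =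
      ∑ i, ∑ j ∈ G.neighborFinset i, inner ℝ (u i - u j) (v i - v j) := by
  have h1 : inner ℝ (G.vectorLaplacian u) v =
      ∑ i, ∑ j ∈ G.neighborFinset i, inner ℝ (u i - u j) (v i) := by
    simp only [PiLp.inner_apply, vectorLaplacian_apply, sum_inner]
  have h2 : inner ℝ (G.vectorLaplacian u) v =
      ∑ i, ∑ j ∈ G.neighborFinset i, -inner ℝ (u i - u j) (v j) := by
    rw [h1, Finset.sum_comm' (t' := Finset.univ) (s' := fun j => G.neighborFinset j)
      (by simp [G.adj_comm])]
    refine Finset.sum_congr rfl fun i _ => Finset.sum_congr rfl fun j _ => ?_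
    rw [← inner_neg_left, neg_sub]
  rw [two_mul]
  nth_rewrite 1 [h1]
  rw [h2, ← Finset.sum_add_distrib]
  refine Finset.sum_congr rfl fun i _ => ?_
  rw [← Finset.sum_add_distrib]
  exact Finset.sum_congr rfl fun j _ => by rw [inner_sub_right, ← sub_eq_add_neg]

theorem isSymmetric_vectorLaplacian : (G.vectorLaplacian (E := E)).IsSymmetric := by
  intro u v
  have h1 := G.two_mul_inner_vectorLaplacian u v
  have h2 := G.two_mul_inner_vectorLaplacian v u
  simp only [real_inner_comm] at h2
  simp only [real_inner_comm] at h1 ⊢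
  linarith

theorem inner_vectorLaplacian_self_nonneg (u : PiLp 2 (fun _ : V => E)) :
    0 ≤ inner ℝ (G.vectorLaplacian u) u := by
  have h := G.two_mul_inner_vectorLaplacian u u
  have : 0 ≤ ∑ i, ∑ j ∈ G.neighborFinset i, inner ℝ (u i - u j) (u i - u j) :=
    Finset.sum_nonneg fun i _ => Finset.sum_nonneg fun j _ => real_inner_self_nonneg
  linarith

variable {G} in
/-- On a connected graph the kernel of the Laplacian consists of constant functions. -/
theorem Connected.eq_of_vectorLaplacian_eq_zero (hG : G.Connected) {u : PiLp 2 (fun _ : V => E)}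
    (hu : G.vectorLaplacian u = 0) (i j : V) : u i = u j := by
  have h := G.two_mul_inner_vectorLaplacian u u
  rw [hu, inner_zero_left, mul_zero, eq_comm,
    Finset.sum_eq_zero_iff_of_nonneg fun i _ =>
      Finset.sum_nonneg fun j _ => real_inner_self_nonneg] at h
  have hadj : ∀ i j, G.Adj i j → u i = u j := fun i j hij => by
    have h' := h i (Finset.mem_univ i)
    rw [Finset.sum_eq_zero_iff_of_nonneg fun j _ => real_inner_self_nonneg] at h'
    exact sub_eq_zero.1 (inner_self_eq_zero.1 (h' j (by simpa using hij)))
  obtain ⟨p⟩ := hG.preconnected i j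
  induction p with
  | nil => rfl
  | cons hab _ ih => exact (hadj _ _ hab).trans ih

variable {G} in
/-- On a connected graph every function with zero sum lies in the range of the Laplacian. -/
theorem Connected.exists_vectorLaplacian_eq [FiniteDimensional ℝ E] (hG : G.Connected)
    {u : PiLp 2 (fun _ : V => E)} (hu : ∑ i, u i = 0) : ∃ v, G.vectorLaplacian v = u := by
  have hmem : u ∈ (LinearMap.range (G.vectorLaplacian (E := E)))ᗮᗮ := by
    rw [G.isSymmetric_vectorLaplacian.orthogonal_range, Submodule.mem_orthogonal]
    intro v hv
    obtain ⟨i₀⟩ := hG.nonempty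
    simp only [PiLp.inner_apply, hG.eq_of_vectorLaplacian_eq_zero (LinearMap.mem_ker.1 hv) _ i₀]
    rw [← inner_sum, hu, inner_zero_right]
  rwa [Submodule.orthogonal_orthogonal] at hmem

end SimpleGraph

theorem hasDerivWithinAt_toLp {ι E : Type*} [Fintype ι] [NormedAddCommGroup E] [NormedSpace ℝ E]
    {u : ι → ℝ → E} {u' : PiLp 2 (fun _ : ι => E)} {s : Set ℝ} {t : ℝ}
    (h : ∀ i, HasDerivWithinAt (u i) (u' i) s t) :
    HasDerivWithinAt (fun t => (WithLp.toLp 2 fun i => u i t : PiLp 2 (fun _ : ι => E))) u' s t := by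
  rw [hasDerivWithinAt_iff_hasFDerivWithinAt, hasFDerivWithinAt_piLp]
  exact fun i => (h i).hasFDerivWithinAt.congr_fderiv (by ext; simp)

/-- Convergence of distributed mirror descent with integral feedback in a finite-dimensional inner
product space, over an arbitrary connected finite graph. -/
theorem tendsto_distributed_mirror_descent {V E : Type*} [Fintype V] [NormedAddCommGroup E]
    [InnerProductSpace ℝ E] [FiniteDimensional ℝ E] {G : SimpleGraph V} [DecidableRel G.Adj]
    (hconn : G.Connected) {f : V → E → ℝ} (hfconv : ∀ i, ConvexOn ℝ Set.univ (f i))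
    (hfdiff : ∀ i x, DifferentiableAt ℝ (f i) x) {xstar : E}
    (hmin : ∀ w, (∑ i, f i xstar) ≤ ∑ i, f i w)
    (huniq : ∀ w, (∀ w', (∑ i, f i w) ≤ ∑ i, f i w') → w = xstar)
    {φ : E → ℝ} (hφdiff : ∀ x, DifferentiableAt ℝ φ x) {μ : ℝ} (hμ : 0 < μ)
    (hφstrong : ConvexOn ℝ Set.univ fun x => φ x - μ / 2 * ‖x‖ ^ 2) {x y z : V → ℝ → E}
    (hz : ∀ i, ∀ t : ℝ, 0 ≤ t → z i t = gradient φ (x i t))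
    (hxcont : ∀ i, ContinuousOn (x i) (Set.Ici 0)) (hy0 : ∀ i, y i 0 = 0)
    (hyderiv : ∀ i, ∀ t : ℝ, 0 ≤ t →
      HasDerivWithinAt (y i) (∑ j ∈ G.neighborFinset i, (x i t - x j t)) (Set.Ici 0) t)
    (hzderiv : ∀ i, ∀ t : ℝ, 0 ≤ t →
      HasDerivWithinAt (z i)
        (-(gradient (f i) (x i t) + (∑ j ∈ G.neighborFinset i, (x i t - x j t)) + y i t))
        (Set.Ici 0) t) :
    ∀ i, Filter.Tendsto (x i) Filter.atTop (nhds xstar) := by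
  have hG : ∀ i w, HasGradientAt (f i) (gradient (f i) w) w :=
    fun i w => (hfdiff i w).hasGradientAt
  have hsum : ∑ i, gradient (f i) xstar = 0 := by
    have hd : HasFDerivAt (fun w => ∑ i, f i w)
        (∑ i, InnerProductSpace.toDual ℝ _ (gradient (f i) xstar)) xstar :=
      HasFDerivAt.fun_sum fun i _ => (hG i xstar).hasFDerivAt
    have h0 := IsLocalMin.hasFDerivAt_eq_zero (Filter.Eventually.of_forall hmin) hd
    rwa [← map_sum, map_eq_zero_iff _ (InnerProductSpace.toDual ℝ _).injective] at h0
  obtain ⟨v₀, hv₀⟩ := hconn.exists_vectorLaplacian_eq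
    (u := WithLp.toLp 2 fun i => -gradient (f i) xstar) (by simp [hsum])
  have hcont : ∀ i, Continuous (f i) := fun i =>
    continuous_iff_continuousAt.2 fun w => (hfdiff i w).continuousAt
  have key : Filter.Tendsto
      (fun t => (WithLp.toLp 2 fun i => x i t : PiLp 2 fun _ : V => E))
      Filter.atTop (nhds (WithLp.toLp 2 fun _ => xstar)) := by
    refine tendsto_mirror_saddle_flow
      (LinearMap.toContinuousLinearMap (G.vectorLaplacian (E := E)))
      (fun u v => G.isSymmetric_vectorLaplacian u v)
      (fun u => G.inner_vectorLaplacian_self_nonneg u)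
      (F := fun u => ∑ i, f i (u i)) (Φ := fun u => ∑ i, φ (u i)) (by fun_prop) hμ
      (y := fun t => WithLp.toLp 2 fun i => y i t) (z := fun t => WithLp.toLp 2 fun i => z i t)
      (g := fun t => WithLp.toLp 2 fun i => gradient (f i) (x i t)) (v₀ := v₀)
      ?_ ?_ ?_ ?_ ?_ ?_ ?_ ?_ ?_
    · intro t _ w
      simp only [PiLp.inner_apply, ← Finset.sum_add_distrib]
      exact Finset.sum_le_sum fun i _ => (hfconv i).add_inner_gradient_le (hG i _) _
    · ext1 i
      simp
    · intro w
      simp only [LinearMap.coe_toContinuousLinearMap', hv₀, PiLp.inner_apply, PiLp.sub_apply,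
        inner_neg_left, Finset.sum_neg_distrib, sub_neg_eq_add, ← Finset.sum_add_distrib]
      exact Finset.sum_le_sum fun i _ => (hfconv i).add_inner_gradient_le (hG i _) _
    · intro w hw hFw
      ext1 i
      have hconst := hconn.eq_of_vectorLaplacian_eq_zero hw
      refine huniq _ fun w' => le_trans (le_of_eq ?_) (hmin w')
      exact (Finset.sum_congr rfl fun j _ => by rw [hconst j i]).trans hFw
    · intro t ht w
      simp only [PiLp.inner_apply, PiLp.norm_sq_eq_of_L2, Finset.mul_sum,
        ← Finset.sum_add_distrib]
      refine Finset.sum_le_sum fun i _ => ?_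
      have h := hφstrong.add_inner_gradient_add_sq_le (hφdiff (x i t)).hasGradientAt (w i)
      rwa [← hz i t ht] at h
    · exact (PiLp.continuous_toLp 2 _).comp_continuousOn (continuousOn_pi.2 hxcont)
    · ext1 i
      simp [hy0]
    · intro t ht
      refine hasDerivWithinAt_toLp fun i => (hyderiv i t ht).congr_deriv ?_
      rw [LinearMap.coe_toContinuousLinearMap', SimpleGraph.vectorLaplacian_apply]
    · intro t ht
      refine hasDerivWithinAt_toLp fun i => (hzderiv i t ht).congr_deriv ?_
      rw [LinearMap.coe_toContinuousLinearMap', PiLp.neg_apply, PiLp.add_apply, PiLp.add_apply,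
        SimpleGraph.vectorLaplacian_apply]
  intro i
  exact ((PiLp.continuous_apply 2 _ i).tendsto _).comp key

end SaddleFlow

/-- Asymptotic convergence of continuous-time distributed mirror descent with
integral feedback (Theorem 1 of the paper). -/
theorem dmd_integral_feedback_asymptotic_convergence
    (n d : ℕ) (G : SimpleGraph (Fin n)) [DecidableRel G.Adj]
    (hconn : G.Connected)
    (f : Fin n → EuclideanSpace ℝ (Fin d) → ℝ)
    (hfconv : ∀ i, ConvexOn ℝ Set.univ (f i))
    (hfdiff : ∀ i x, DifferentiableAt ℝ (f i) x)
    (σ : ℝ) (hσ : 0 < σ)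
    (hFstrong : ConvexOn ℝ Set.univ
      (fun x : EuclideanSpace ℝ (Fin d) => (∑ i, f i x) - σ / 2 * ‖x‖ ^ 2))
    (xstar : EuclideanSpace ℝ (Fin d))
    (hmin : ∀ w, (∑ i, f i xstar) ≤ ∑ i, f i w)
    (huniq : ∀ w, (∀ w', (∑ i, f i w) ≤ ∑ i, f i w') → w = xstar)
    (φ : EuclideanSpace ℝ (Fin d) → ℝ)
    (hφdiff : ∀ x, DifferentiableAt ℝ φ x)
    (μ : ℝ) (hμ : 0 < μ)
    (hφstrong : ConvexOn ℝ Set.univ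
      (fun x : EuclideanSpace ℝ (Fin d) => φ x - μ / 2 * ‖x‖ ^ 2))
    (x y z : Fin n → ℝ → EuclideanSpace ℝ (Fin d))
    (hz : ∀ i, ∀ t : ℝ, 0 ≤ t → z i t = gradient φ (x i t))
    (hxcont : ∀ i, ContinuousOn (x i) (Set.Ici 0))
    (hy0 : ∀ i, y i 0 = 0)
    (hyderiv : ∀ i, ∀ t : ℝ, 0 ≤ t →
      HasDerivWithinAt (y i) (∑ j ∈ G.neighborFinset i, (x i t - x j t))
        (Set.Ici 0) t)
    (hzderiv : ∀ i, ∀ t : ℝ, 0 ≤ t →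
      HasDerivWithinAt (z i)
        (-(gradient (f i) (x i t) + (∑ j ∈ G.neighborFinset i, (x i t - x j t))
            + y i t))
        (Set.Ici 0) t) :
    ∀ i, Filter.Tendsto (x i) Filter.atTop (nhds xstar) := by
  exact tendsto_distributed_mirror_descent hconn hfconv hfdiff hmin huniq hφdiff hμ hφstrong hz hxcont
    hy0 hyderiv hzderiv
end

section
/- There exist δ > 0, C > 0 and α > 0 with the following property. Suppose for each i ∈ {1,…,n} there are functions x_i, y_i, z_i : [0,∞) → ℝ^d such that: z_i(t) = ∇φ(x_i(t)) for all t ≥ 0; each x_i is continuous; Σ_{i=1}^n y_i(0) = 0; for every t ≥ 0, y_i has derivative Σ_{j ∈ N_i}(x_i(t) − x_j(t)) at t, and z_i has derivative −(∇f_i(x_i(t)) + Σ_{j ∈ N_i}(x_i(t) − x_j(t)) + y_i(t)) at t. Define ρ(t) = ( Σ_{i=1}^n ( ‖x_i(t) − x*‖² + ‖y_i(t) + ∇f_i(x*)‖² + ‖z_i(t) − ∇φ(x*)‖² ) )^{1/2}. If ρ(0) ≤ δ, then ρ(t) ≤ C e^{−α t} ρ(0) for all t ≥ 0. -/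
open scoped BigOperators

section Helpers

open Set Filter Topology
open scoped RealInnerProductSpace

/-- A continuous function satisfying `V' ≤ -α V` wherever `q ≤ r` decays exponentially, provided
`V` controls `q ^ 2` and starts too small to let `q` reach `r`. -/
theorem le_exp_of_deriv_le_of_trapped {V V' q : ℝ → ℝ} {α r c : ℝ}
    (hα : 0 < α) (hr : 0 < r) (hc : 0 < c)
    (hV : ContinuousOn V (Ici 0)) (hq : ContinuousOn q (Ici 0))
    (hder : ∀ t, 0 < t → HasDerivAt V (V' t) t)
    (hdecay : ∀ t, 0 < t → q t ≤ r → V' t ≤ -α * V t)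
    (hlow : ∀ t, 0 ≤ t → q t ≤ r → c * q t ^ 2 ≤ V t)
    (hq0 : q 0 < r) (hV0 : V 0 < c * r ^ 2) {t : ℝ} (ht : 0 ≤ t) :
    q t ≤ r ∧ V t ≤ Real.exp (-α * t) * V 0 := by
  have decay : ∀ T, 0 ≤ T → (∀ s ∈ Icc 0 T, q s ≤ r) → V T ≤ Real.exp (-α * T) * V 0 := by
    intro T hT hs
    have hd : ∀ s, 0 < s → HasDerivAt (fun s => Real.exp (α * s) * V s)
        (Real.exp (α * s) * (α * 1) * V s + Real.exp (α * s) * V' s) s := fun s hs =>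
      (((hasDerivAt_id s).const_mul α).exp).mul (hder s hs)
    have hanti : AntitoneOn (fun s => Real.exp (α * s) * V s) (Icc 0 T) := by
      refine antitoneOn_of_deriv_nonpos (convex_Icc _ _) ?_ ?_ ?_
      · exact (by fun_prop : Continuous fun s : ℝ => Real.exp (α * s)).continuousOn.mul
          (hV.mono Icc_subset_Ici_self)
      · intro s hs
        rw [interior_Icc] at hs
        exact (hd s hs.1).differentiableAt.differentiableWithinAt
      · intro s hs'
        rw [interior_Icc] at hs'
        rw [(hd s hs'.1).deriv]
        have := hdecay s hs'.1 (hs s (Ioo_subset_Icc_self hs'))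
        have he := Real.exp_pos (α * s)
        nlinarith
    have h := hanti (left_mem_Icc.2 hT) (right_mem_Icc.2 hT) hT
    simp only [mul_zero, Real.exp_zero, one_mul] at h
    calc V T = Real.exp (-α * T) * (Real.exp (α * T) * V T) := by
          rw [← mul_assoc, ← Real.exp_add]; simp
      _ ≤ _ := by gcongr
  have trapped : ∀ t, 0 ≤ t → q t ≤ r := by
    intro t₁ ht₁
    by_contra! hlt
    have hS : IsCompact {s ∈ Icc 0 t₁ | r ≤ q s} := by
      have := (hq.mono (fun s hs => hs.1 : Icc 0 t₁ ⊆ Ici 0)).preimage_isClosed_of_isClosed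
        isClosed_Icc (isClosed_Ici (a := r))
      exact isCompact_Icc.of_isClosed_subset this fun s hs => hs.1
    obtain ⟨t₀, ⟨⟨h0, h01⟩, hrt⟩, hleast⟩ := hS.exists_isLeast ⟨t₁, ⟨ht₁, le_rfl⟩, hlt.le⟩
    have hrt' : q t₀ ≤ r := by
      obtain ⟨s, hs, hqs⟩ := intermediate_value_Icc h0
        (hq.mono (fun s hs => hs.1 : Icc 0 t₀ ⊆ Ici 0)) ⟨hq0.le, hrt⟩
      have : t₀ ≤ s := hleast ⟨⟨hs.1, hs.2.trans h01⟩, hqs.ge⟩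
      rw [le_antisymm this hs.2, hqs]
    have hle : ∀ s ∈ Icc 0 t₀, q s ≤ r := by
      intro s hs
      rcases hs.2.eq_or_lt with rfl | hlt'
      · exact hrt'
      · by_contra! h
        exact hlt'.not_ge (hleast ⟨⟨hs.1, hs.2.trans h01⟩, h.le⟩)
    have h1 := decay t₀ h0 hle
    have h2 := hlow t₀ h0 hrt'
    have h3 : 0 ≤ V 0 := (by positivity : 0 ≤ c * q 0 ^ 2).trans (hlow 0 le_rfl hq0.le)
    have h4 : Real.exp (-α * t₀) ≤ 1 := Real.exp_le_one_iff.2 (by nlinarith)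
    have h5 : Real.exp (-α * t₀) * V 0 ≤ V 0 := mul_le_of_le_one_left h3 h4
    have h6 : r ^ 2 ≤ q t₀ ^ 2 := by gcongr
    nlinarith
  exact ⟨trapped t ht, decay t ht fun s hs => trapped s hs.1⟩

section Hilbert

variable {H : Type*} [NormedAddCommGroup H] [InnerProductSpace ℝ H]

/-- The first-order characterization of strong convexity. -/
theorem ConvexOn.add_inner_gradient_add_le [CompleteSpace H] {f : H → ℝ} {m : ℝ}
    (hf : ConvexOn ℝ univ fun x => f x - m / 2 * ‖x‖ ^ 2) {x : H} (hfx : DifferentiableAt ℝ f x)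
    (y : H) : f x + ⟪gradient f x, y - x⟫ + m / 2 * ‖y - x‖ ^ 2 ≤ f y := by
  have hg : HasFDerivAt (fun x => f x - m / 2 * ‖x‖ ^ 2)
      (fderiv ℝ f x - (m / 2) • (2 • innerSL ℝ x)) x :=
    hfx.hasFDerivAt.sub ((hasStrictFDerivAt_norm_sq x).hasFDerivAt.const_mul (m / 2))
  have hlim := (hg.hasLineDerivAt (y - x)).tendsto_slope_zero_right
  have key : (fderiv ℝ f x - (m / 2) • (2 • innerSL ℝ x)) (y - x)
      ≤ (f y - m / 2 * ‖y‖ ^ 2) - (f x - m / 2 * ‖x‖ ^ 2) := by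
    refine le_of_tendsto hlim ?_
    filter_upwards [Ioo_mem_nhdsGT (zero_lt_one (α := ℝ))] with s hs
    have := hf.2 (mem_univ x) (mem_univ y) (sub_nonneg.2 hs.2.le) hs.1.le (by ring)
    have hxy : (1 - s) • x + s • y = x + s • (y - x) := by module
    rw [hxy] at this
    simp only [smul_eq_mul] at this ⊢
    rw [inv_mul_le_iff₀ hs.1]
    linarith
  have hgrad : fderiv ℝ f x (y - x) = ⟪gradient f x, y - x⟫ :=
    hfx.hasGradientAt.fderiv_apply
  have hy : ‖y‖ ^ 2 = ‖x‖ ^ 2 + 2 * ⟪x, y - x⟫ + ‖y - x‖ ^ 2 := by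
    rw [← norm_add_sq_real, add_sub_cancel]
  simp only [sub_apply, smul_apply, smul_eq_mul,
    innerSL_apply_apply, nsmul_eq_mul, hgrad] at key
  push_cast at key
  rw [hy] at key
  linarith

theorem ConvexOn.mul_norm_sq_le_inner_gradient_sub [CompleteSpace H] {f : H → ℝ} {m : ℝ}
    (hf : ConvexOn ℝ univ fun x => f x - m / 2 * ‖x‖ ^ 2) {x y : H} (hfx : DifferentiableAt ℝ f x)
    (hfy : DifferentiableAt ℝ f y) :
    m * ‖y - x‖ ^ 2 ≤ ⟪gradient f y - gradient f x, y - x⟫ := by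
  have h1 := hf.add_inner_gradient_add_le hfx y
  have h2 := hf.add_inner_gradient_add_le hfy x
  rw [← neg_sub y x, inner_neg_right, norm_neg] at h2
  rw [inner_sub_left]
  linarith

theorem exists_pos_mul_norm_sq_le_inner [FiniteDimensional ℝ H] (A : H →L[ℝ] H)
    (hA : ∀ u, u ≠ 0 → 0 < ⟪A u, u⟫) : ∃ c > 0, ∀ u, c * ‖u‖ ^ 2 ≤ ⟪A u, u⟫ := by
  by_cases hne : (Metric.sphere (0 : H) 1).Nonempty
  · obtain ⟨v, hv, hmin⟩ := (isCompact_sphere (0 : H) 1).exists_isMinOn hne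
      (f := fun u => ⟪A u, u⟫) (by fun_prop)
    refine ⟨⟪A v, v⟫, hA v ?_, fun u => ?_⟩
    · rintro rfl
      simp at hv
    · by_cases hu : u = 0
      · simp [hu]
      · have hu' : ‖u‖ ≠ 0 := norm_ne_zero_iff.2 hu
        have h : ⟪A v, v⟫ ≤ ⟪A (‖u‖⁻¹ • u), ‖u‖⁻¹ • u⟫ := hmin (by simp [norm_smul, hu'])
        rw [map_smul, real_inner_smul_left, real_inner_smul_right] at h
        calc ⟪A v, v⟫ * ‖u‖ ^ 2 ≤ ‖u‖⁻¹ * (‖u‖⁻¹ * ⟪A u, u⟫) * ‖u‖ ^ 2 := by gcongr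
          _ = ⟪A u, u⟫ := by field_simp
  · refine ⟨1, one_pos, fun u => ?_⟩
    have hu : u = 0 := by
      by_contra hu
      exact hne ⟨‖u‖⁻¹ • u, by simp [norm_smul, norm_ne_zero_iff.2 hu]⟩
    simp [hu]

/-- A positive semidefinite symmetric operator has a symmetric right inverse on the orthogonal
complement of its kernel, given by the inverse of a positive definite operator. -/
theorem exists_symmetric_inverse_on_ker_orthogonal [FiniteDimensional ℝ H] {L : H →L[ℝ] H}
    (hsymm : (L : H →ₗ[ℝ] H).IsSymmetric) (hnonneg : ∀ u, 0 ≤ ⟪L u, u⟫)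
    (hker : ∀ u, ⟪L u, u⟫ = 0 → L u = 0) :
    ∃ P : H →L[ℝ] H, (P : H →ₗ[ℝ] H).IsSymmetric ∧
      (∃ c > 0, ∀ v, c * ‖v‖ ^ 2 ≤ ⟪P v, v⟫) ∧
      ∀ v, (∀ k, L k = 0 → ⟪k, v⟫ = 0) → ∀ u, ⟪P v, L u⟫ = ⟪v, u⟫ := by
  let K : Submodule ℝ H := LinearMap.ker (L : H →ₗ[ℝ] H)
  have hK : ∀ {u}, u ∈ K ↔ L u = 0 := Iff.rfl
  let T : H →ₗ[ℝ] H := (L + K.starProjection : H →L[ℝ] H)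
  have hTapp : ∀ u, T u = L u + K.starProjection u := fun _ => rfl
  have hTsymm : T.IsSymmetric := hsymm.add (Submodule.starProjection_isSymmetric K)
  have hpi : ∀ u, ⟪K.starProjection u, u⟫ = ‖K.starProjection u‖ ^ 2 := by
    intro u
    rw [← real_inner_self_eq_norm_sq, ← Submodule.inner_starProjection_left_eq_right,
      Submodule.starProjection_eq_self_iff.2 (Submodule.starProjection_apply_mem K u)]
  have hTpos : ∀ u, u ≠ 0 → 0 < ⟪T u, u⟫ := by
    intro u hu
    rw [hTapp, inner_add_left, hpi]
    have h1 := hnonneg u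
    refine lt_of_le_of_ne (by positivity) fun h => hu ?_
    have h2 : ⟪L u, u⟫ = 0 := by nlinarith [sq_nonneg ‖K.starProjection u‖]
    have h3 : ‖K.starProjection u‖ ^ 2 = 0 := by linarith
    have h4 : K.starProjection u = 0 := by simpa using h3
    rwa [Submodule.starProjection_eq_self_iff.2 (hK.2 (hker u h2))] at h4
  have hTinj : Function.Injective T := by
    rw [injective_iff_map_eq_zero]
    intro u hu
    by_contra hne
    simpa [hu] using hTpos u hne
  let e : H ≃ₗ[ℝ] H := LinearEquiv.ofInjectiveEndo T hTinj
  have he : ∀ v, T (e.symm v) = v := e.apply_symm_apply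
  have hPsymm : ∀ a b, ⟪e.symm a, b⟫ = ⟪a, e.symm b⟫ := by
    intro a b
    conv_lhs => rw [← he b]
    conv_rhs => rw [← he a]
    exact (hTsymm _ _).symm
  refine ⟨LinearMap.toContinuousLinearMap (e.symm : H →ₗ[ℝ] H), hPsymm, ?_, ?_⟩
  · refine exists_pos_mul_norm_sq_le_inner _ fun v hv => ?_
    change 0 < ⟪e.symm v, v⟫
    have := hTpos (e.symm v) (by simpa using hv)
    rwa [he, real_inner_comm] at this
  · intro v hv u
    change ⟪e.symm v, L u⟫ = ⟪v, u⟫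
    set p := e.symm v with hp
    have h1 : L p + K.starProjection p = v := he v
    have h2 : K.starProjection p = 0 := by
      have hmem : L (K.starProjection p) = 0 := hK.1 (Submodule.starProjection_apply_mem K p)
      have h3 := hv _ hmem
      rw [← h1, inner_add_right, ← hsymm.apply_clm, hmem, inner_zero_left, zero_add] at h3
      exact inner_self_eq_zero.1 h3
    rw [h2, add_zero] at h1
    rw [← hsymm.apply_clm, h1]

/-- Along a trajectory on which `W ∘ u` is differentiable, a function `B` of which `u` is a
subgradient with respect to the variable `W u` satisfies the chain rule. -/
theorem hasDerivWithinAt_of_subgradient {W : H → H} {B : H → ℝ}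
    (hB : ∀ a b, ⟪W a - W b, b⟫ ≤ B a - B b) {u : ℝ → H} {w' : H} {S : Set ℝ} {t : ℝ}
    (hu : ContinuousWithinAt u S t) (hw : HasDerivWithinAt (fun s => W (u s)) w' S t) :
    HasDerivWithinAt (fun s => B (u s)) ⟪w', u t⟫ S t := by
  have hg : HasDerivWithinAt (fun s => ⟪W (u s), u t⟫) ⟪w', u t⟫ S t := by
    simpa using hw.inner ℝ (hasDerivWithinAt_const t S (u t))
  have hh : HasDerivWithinAt (fun s => B (u s) - ⟪W (u s), u t⟫) 0 S t := by
    rw [hasDerivWithinAt_iff_isLittleO]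
    have hO : (fun s => W (u s) - W (u t)) =O[𝓝[S] t] fun s => s - t :=
      hw.hasFDerivWithinAt.isBigO_sub
    have ho : (fun s => u s - u t) =o[𝓝[S] t] fun _ => (1 : ℝ) := by
      rw [Asymptotics.isLittleO_one_iff]
      exact tendsto_sub_nhds_zero_iff.2 hu
    refine Asymptotics.IsBigO.trans_isLittleO (.of_bound 1 (.of_forall fun s => ?_))
      (by simpa using hO.norm_left.mul_isLittleO ho.norm_left)
    have h1 := hB (u s) (u t)
    have h2 := hB (u t) (u s)
    have h3 := real_inner_le_norm (W (u s) - W (u t)) (u s - u t)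
    rw [smul_zero, sub_zero, one_mul, Real.norm_eq_abs, abs_le, norm_mul, norm_norm, norm_norm]
    simp only [inner_sub_left, inner_sub_right] at h1 h2 h3
    constructor <;> linarith
  simpa [Pi.add_def] using hh.add hg

theorem HasFDerivAt.le_inner_of_forall_pos {N : H → H} {A : H →L[ℝ] H} (hN : HasFDerivAt N A 0)
    (hN0 : N 0 = 0) {u : H} {m : ℝ} (h : ∀ s : ℝ, 0 < s → m * s ^ 2 ≤ ⟪N (s • u), s • u⟫) :
    m ≤ ⟪A u, u⟫ := by
  have hlim := ((hN.hasLineDerivAt u).tendsto_slope_zero_right).inner (𝕜 := ℝ) (tendsto_const_nhds (x := u))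
  refine ge_of_tendsto hlim ?_
  filter_upwards [self_mem_nhdsWithin] with s hs
  have hs : 0 < s := hs
  have := h s hs
  rw [zero_add, hN0, sub_zero, real_inner_smul_left, le_inv_mul_iff₀ hs]
  rw [real_inner_smul_right] at this
  nlinarith

theorem HasFDerivAt.eventually_mul_norm_sq_le_inner {N : H → H} {A : H →L[ℝ] H}
    (hN : HasFDerivAt N A 0) (hN0 : N 0 = 0) {c c' : ℝ} (hc' : c' < c)
    (hA : ∀ u, c * ‖u‖ ^ 2 ≤ ⟪A u, u⟫) : ∀ᶠ u in 𝓝 0, c' * ‖u‖ ^ 2 ≤ ⟪N u, u⟫ := by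
  filter_upwards [hN.isLittleO.def (sub_pos.2 hc')] with u hu
  rw [hN0, sub_zero, sub_zero] at hu
  have h1 := hA u
  have h2 := neg_le_of_abs_le (abs_real_inner_le_norm (N u - A u) u)
  have h3 : ‖N u - A u‖ * ‖u‖ ≤ (c - c') * ‖u‖ * ‖u‖ := by gcongr
  rw [inner_sub_left] at h2
  nlinarith

theorem HasFDerivAt.exists_eventually_norm_le {N : H → H} {A : H →L[ℝ] H}
    (hN : HasFDerivAt N A 0) (hN0 : N 0 = 0) : ∃ K > 0, ∀ᶠ u in 𝓝 0, ‖N u‖ ≤ K * ‖u‖ := by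
  obtain ⟨K, hK, h⟩ := hN.isBigO_sub.exists_pos
  exact ⟨K, hK, by simpa [hN0] using h.bound⟩

theorem exists_eventually_mul_norm_sq_le_inner_add [FiniteDimensional ℝ H] {L : H →L[ℝ] H}
    (hnonneg : ∀ u, 0 ≤ ⟪L u, u⟫) (hker : ∀ u, ⟪L u, u⟫ = 0 → L u = 0)
    {N : H → H} (hN : DifferentiableAt ℝ N 0) (hN0 : N 0 = 0) (hmono : ∀ u, 0 ≤ ⟪N u, u⟫)
    {m : ℝ} (hm : 0 < m) (hstrong : ∀ u, L u = 0 → m * ‖u‖ ^ 2 ≤ ⟪N u, u⟫) :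
    ∃ c > 0, ∀ᶠ u in 𝓝 0, c * ‖u‖ ^ 2 ≤ ⟪N u, u⟫ + ⟪L u, u⟫ := by
  have hA := hN.hasFDerivAt
  set A := fderiv ℝ N 0
  obtain ⟨c, hc, hcA⟩ := exists_pos_mul_norm_sq_le_inner (A + L) fun u hu => by
    have h1 : 0 ≤ ⟪A u, u⟫ := hA.le_inner_of_forall_pos hN0 fun s _ => by
      simpa using hmono (s • u)
    have h2 := hnonneg u
    rw [add_apply, inner_add_left]
    by_cases h : ⟪L u, u⟫ = 0
    · have h3 : m * ‖u‖ ^ 2 ≤ ⟪A u, u⟫ := hA.le_inner_of_forall_pos hN0 fun s _ => by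
        have := hstrong (s • u) (by rw [map_smul, hker u h, smul_zero])
        rw [norm_smul, mul_pow, Real.norm_eq_abs, sq_abs] at this
        linarith
      have : 0 < ‖u‖ := norm_pos_iff.2 hu
      have : 0 < m * ‖u‖ ^ 2 := by positivity
      linarith
    · have := lt_of_le_of_ne h2 (Ne.symm h)
      linarith
  refine ⟨c / 2, by positivity, ?_⟩
  filter_upwards [(hA.add L.hasFDerivAt).eventually_mul_norm_sq_le_inner (by simp [hN0])
    (half_lt_self hc) hcA] with u hu
  simpa [inner_add_left] using hu

/-- Lyapunov function of the flow `v' = L u`, `w' = -(N u + L u + v)`, `w = W u`. -/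
noncomputable def feedbackLyapunov (P : H →L[ℝ] H) (W : H → H) (B : H → ℝ) (ε : ℝ) (a b : H) : ℝ :=
  B a + ⟪P b, b⟫ / 2 + ε * ⟪W a, b⟫

/-- Derivative of `feedbackLyapunov` along the flow `v' = L u`, `w' = -(N u + L u + v)`. -/
noncomputable def feedbackLyapunovDeriv (L P : H →L[ℝ] H) (N W : H → H) (ε : ℝ) (a b : H) : ℝ :=
  ⟪-(N a + L a + b), a⟫ + ⟪P b, L a⟫ + ε * (⟪W a, L a⟫ + ⟪-(N a + L a + b), b⟫)

theorem hasDerivWithinAt_feedbackLyapunov {L P : H →L[ℝ] H}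
    (hPsymm : (P : H →ₗ[ℝ] H).IsSymmetric) {N W : H → H} {B : H → ℝ}
    (hB : ∀ a b, ⟪W a - W b, b⟫ ≤ B a - B b) (ε : ℝ) {u v : ℝ → H} {S : Set ℝ} {t : ℝ}
    (hu : ContinuousWithinAt u S t) (hv : HasDerivWithinAt v (L (u t)) S t)
    (hw : HasDerivWithinAt (fun t => W (u t)) (-(N (u t) + L (u t) + v t)) S t) :
    HasDerivWithinAt (fun t => feedbackLyapunov P W B ε (u t) (v t))
      (feedbackLyapunovDeriv L P N W ε (u t) (v t)) S t := by
  have h1 := hasDerivWithinAt_of_subgradient hB hu hw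
  have h2 := (P.hasFDerivAt.comp_hasDerivWithinAt t hv).inner ℝ hv
  have h3 := hw.inner ℝ hv
  refine ((h1.add (h2.div_const 2)).add (h3.const_mul ε)).congr_deriv ?_
  simp only [feedbackLyapunovDeriv, Function.comp_apply]
  rw [hPsymm.apply_clm (L (u t)), real_inner_comm (P (v t)) (L (u t)), hPsymm.apply_clm]
  ring

theorem exists_feedbackLyapunov_bounds [FiniteDimensional ℝ H] {L : H →L[ℝ] H}
    (hsymm : (L : H →ₗ[ℝ] H).IsSymmetric) (hnonneg : ∀ u, 0 ≤ ⟪L u, u⟫)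
    (hker : ∀ u, ⟪L u, u⟫ = 0 → L u = 0)
    {N : H → H} (hN : DifferentiableAt ℝ N 0) (hN0 : N 0 = 0) (hmono : ∀ u, 0 ≤ ⟪N u, u⟫)
    {m : ℝ} (hm : 0 < m) (hstrong : ∀ u, L u = 0 → m * ‖u‖ ^ 2 ≤ ⟪N u, u⟫)
    {W : H → H} (hW : DifferentiableAt ℝ W 0) (hW0 : W 0 = 0)
    {B : H → ℝ} (hB0 : B 0 = 0) {μ : ℝ} (hμ : 0 < μ) (hBlow : ∀ u, μ * ‖u‖ ^ 2 ≤ B u)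
    (hB : ∀ a b, ⟪W a - W b, b⟫ ≤ B a - B b) :
    ∃ P : H →L[ℝ] H, (P : H →ₗ[ℝ] H).IsSymmetric ∧ ∃ ε : ℝ,
      ∃ r > 0, ∃ c₁ > 0, ∃ c₂ > 0, ∃ α > 0, ∃ K > 0, ∀ a, ‖a‖ ≤ r →
        ‖W a‖ ≤ K * ‖a‖ ∧ ∀ b,
          c₁ * (‖a‖ ^ 2 + ‖b‖ ^ 2) ≤ feedbackLyapunov P W B ε a b ∧
          feedbackLyapunov P W B ε a b ≤ c₂ * (‖a‖ ^ 2 + ‖b‖ ^ 2) ∧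
          ((∀ k, L k = 0 → ⟪k, b⟫ = 0) →
            feedbackLyapunovDeriv L P N W ε a b ≤ -α * feedbackLyapunov P W B ε a b) := by
  obtain ⟨P, hPsymm, ⟨p, hp, hPlow⟩, hPL⟩ :=
    exists_symmetric_inverse_on_ker_orthogonal hsymm hnonneg hker
  obtain ⟨c, hc, hcoer⟩ :=
    exists_eventually_mul_norm_sq_le_inner_add hnonneg hker hN hN0 hmono hm hstrong
  obtain ⟨KN, hKN, hNle⟩ := hN.hasFDerivAt.exists_eventually_norm_le hN0
  obtain ⟨KW, hKW, hWle⟩ := hW.hasFDerivAt.exists_eventually_norm_le hW0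
  obtain ⟨r, hr, hball⟩ := Metric.nhds_basis_closedBall.eventually_iff.1
    (hcoer.and (hNle.and hWle))
  replace hball : ∀ u : H, ‖u‖ ≤ r → c * ‖u‖ ^ 2 ≤ ⟪N u, u⟫ + ⟪L u, u⟫ ∧
      ‖N u‖ ≤ KN * ‖u‖ ∧ ‖W u‖ ≤ KW * ‖u‖ := fun u hu => hball (by simpa using hu)
  set l := ‖L‖
  have hLle : ∀ u, ‖L u‖ ≤ l * ‖u‖ := L.le_opNorm
  have hl : 0 ≤ l := norm_nonneg _
  set R := (KN + l) ^ 2 / 2 + KW * l with hR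
  have hR0 : 0 ≤ R := by positivity
  set c₁ := min μ (p / 2)
  have hc₁0 : 0 < c₁ := by positivity
  obtain ⟨ε, hε, hεK, hεR⟩ : ∃ ε > 0, ε * KW ≤ c₁ ∧ ε * R ≤ c / 2 := by
    refine ⟨min (c₁ / KW) (c / 2 / (R + 1)), by positivity, ?_, ?_⟩
    · calc _ ≤ c₁ / KW * KW := by gcongr; exact min_le_left _ _
        _ = c₁ := by field_simp
    · calc _ ≤ c / 2 / (R + 1) * (R + 1) := by
            gcongr
            · exact min_le_right _ _
            · linarith
        _ = c / 2 := by field_simp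
  set c₂ := KW + ‖P‖ + ε * KW with hc₂
  have hc₂0 : 0 < c₂ := by positivity
  set κ := min (c / 2) (ε / 2)
  have hκ0 : 0 < κ := by positivity
  have hVlow : ∀ a b, ‖a‖ ≤ r → c₁ / 2 * (‖a‖ ^ 2 + ‖b‖ ^ 2) ≤ feedbackLyapunov P W B ε a b := by
    intro a b ha
    have h1 := hBlow a
    have h2 := hPlow b
    have h3 := neg_le_of_abs_le (abs_real_inner_le_norm (W a) b)
    have h4 : ‖W a‖ * ‖b‖ ≤ KW * ‖a‖ * ‖b‖ := by gcongr; exact (hball a ha).2.2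
    have h5 : c₁ * ‖a‖ ^ 2 ≤ μ * ‖a‖ ^ 2 := by gcongr; exact min_le_left _ _
    have h6 : c₁ * ‖b‖ ^ 2 ≤ p / 2 * ‖b‖ ^ 2 := by gcongr; exact min_le_right _ _
    have h7 : ε * KW * (‖a‖ * ‖b‖) ≤ c₁ * (‖a‖ * ‖b‖) := by gcongr
    have h8 : ε * -(KW * ‖a‖ * ‖b‖) ≤ ε * ⟪W a, b⟫ := by gcongr; linarith
    have h9 : 0 ≤ c₁ * (‖a‖ - ‖b‖) ^ 2 := by positivity
    simp only [feedbackLyapunov]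
    linarith
  have hVup : ∀ a b, ‖a‖ ≤ r → feedbackLyapunov P W B ε a b ≤ c₂ * (‖a‖ ^ 2 + ‖b‖ ^ 2) := by
    intro a b ha
    have h1 : B a ≤ ⟪W a, a⟫ := by
      have := hB 0 a
      simp only [hW0, hB0, zero_sub, inner_neg_left] at this
      linarith
    have h2 := real_inner_le_norm (W a) a
    have h3 := real_inner_le_norm (W a) b
    have h4 := real_inner_le_norm (P b) b
    have h5 := P.le_opNorm b
    have hWa := (hball a ha).2.2
    have h6 : ‖W a‖ * ‖a‖ ≤ KW * ‖a‖ * ‖a‖ := by gcongr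
    have h7 : ‖W a‖ * ‖b‖ ≤ KW * ‖a‖ * ‖b‖ := by gcongr
    have h8 : ‖P b‖ * ‖b‖ ≤ ‖P‖ * ‖b‖ * ‖b‖ := by gcongr
    have h9 : ε * ⟪W a, b⟫ ≤ ε * (KW * ‖a‖ * ‖b‖) := by gcongr; linarith
    have h10 : 0 ≤ ε * KW * ((‖a‖ - ‖b‖) ^ 2 + ‖a‖ ^ 2 + ‖b‖ ^ 2) := by positivity
    have h11 : 0 ≤ KW * ‖b‖ ^ 2 := by positivity
    have h12 : 0 ≤ ‖P‖ * ‖b‖ ^ 2 := by positivity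
    have h13 : 0 ≤ ‖P‖ * ‖a‖ ^ 2 := by positivity
    simp only [feedbackLyapunov, hc₂]
    linarith
  have hVdecay : ∀ a b, ‖a‖ ≤ r → (∀ k, L k = 0 → ⟪k, b⟫ = 0) →
      feedbackLyapunovDeriv L P N W ε a b ≤
        -(κ / c₂) * feedbackLyapunov P W B ε a b := by
    intro a b ha hb
    obtain ⟨h1, hNa, hWa⟩ := hball a ha
    have hLa := hLle a
    have h2 := real_inner_le_norm (W a) (L a)
    have h3 : ‖W a‖ * ‖L a‖ ≤ (KW * ‖a‖) * (l * ‖a‖) := by gcongr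
    have h4 := neg_le_of_abs_le (abs_real_inner_le_norm (N a) b)
    have h5 : ‖N a‖ * ‖b‖ ≤ KN * ‖a‖ * ‖b‖ := by gcongr
    have h6 := neg_le_of_abs_le (abs_real_inner_le_norm (L a) b)
    have h7 : ‖L a‖ * ‖b‖ ≤ l * ‖a‖ * ‖b‖ := by gcongr
    have h8 : ⟪W a, L a⟫ + ⟪-(N a + L a + b), b⟫ ≤ R * ‖a‖ ^ 2 - ‖b‖ ^ 2 / 2 := by
      rw [inner_neg_left, inner_add_left, inner_add_left, real_inner_self_eq_norm_sq, hR]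
      linarith [sq_nonneg ((KN + l) * ‖a‖ - ‖b‖)]
    have h9 : ε * (⟪W a, L a⟫ + ⟪-(N a + L a + b), b⟫) ≤ ε * (R * ‖a‖ ^ 2 - ‖b‖ ^ 2 / 2) := by
      gcongr
    have h10 : ε * R * ‖a‖ ^ 2 ≤ c / 2 * ‖a‖ ^ 2 := by gcongr
    have h11 : κ * ‖a‖ ^ 2 ≤ c / 2 * ‖a‖ ^ 2 := by gcongr; exact min_le_left _ _
    have h12 : κ * ‖b‖ ^ 2 ≤ ε / 2 * ‖b‖ ^ 2 := by gcongr; exact min_le_right _ _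
    have h13 : feedbackLyapunovDeriv L P N W ε a b ≤ -κ * (‖a‖ ^ 2 + ‖b‖ ^ 2) := by
      simp only [feedbackLyapunovDeriv]
      rw [hPL b hb a]
      have : ⟪-(N a + L a + b), a⟫ = -⟪N a, a⟫ - ⟪L a, a⟫ - ⟪b, a⟫ := by
        rw [inner_neg_left, inner_add_left, inner_add_left]; ring
      linarith
    have h14 : κ / c₂ * feedbackLyapunov P W B ε a b ≤ κ / c₂ * (c₂ * (‖a‖ ^ 2 + ‖b‖ ^ 2)) := by
      gcongr; exact hVup a b ha
    have h15 : κ / c₂ * (c₂ * (‖a‖ ^ 2 + ‖b‖ ^ 2)) = κ * (‖a‖ ^ 2 + ‖b‖ ^ 2) := by field_simp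
    linarith
  exact ⟨P, hPsymm, ε, r, hr, c₁ / 2, by positivity, c₂, hc₂0, κ / c₂, by positivity, KW, hKW,
    fun a ha => ⟨(hball a ha).2.2, fun b => ⟨hVlow a b ha, hVup a b ha, hVdecay a b ha⟩⟩⟩

/-- Local exponential stability of the flow `v' = L u`, `w' = -(N u + L u + v)`, `w = W u`. -/
theorem exists_exponential_decay_of_integral_feedback [FiniteDimensional ℝ H] {L : H →L[ℝ] H}
    (hsymm : (L : H →ₗ[ℝ] H).IsSymmetric) (hnonneg : ∀ u, 0 ≤ ⟪L u, u⟫)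
    (hker : ∀ u, ⟪L u, u⟫ = 0 → L u = 0)
    {N : H → H} (hN : DifferentiableAt ℝ N 0) (hN0 : N 0 = 0) (hmono : ∀ u, 0 ≤ ⟪N u, u⟫)
    {m : ℝ} (hm : 0 < m) (hstrong : ∀ u, L u = 0 → m * ‖u‖ ^ 2 ≤ ⟪N u, u⟫)
    {W : H → H} (hW : DifferentiableAt ℝ W 0) (hW0 : W 0 = 0)
    {B : H → ℝ} (hB0 : B 0 = 0) {μ : ℝ} (hμ : 0 < μ) (hBlow : ∀ u, μ * ‖u‖ ^ 2 ≤ B u)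
    (hB : ∀ a b, ⟪W a - W b, b⟫ ≤ B a - B b) :
    ∃ δ > 0, ∃ C > 0, ∃ α > 0, ∀ u v : ℝ → H, ContinuousOn u (Ici 0) →
      (∀ k, L k = 0 → ⟪k, v 0⟫ = 0) →
      (∀ t, 0 ≤ t → HasDerivWithinAt v (L (u t)) (Ici 0) t) →
      (∀ t, 0 ≤ t → HasDerivWithinAt (fun t => W (u t)) (-(N (u t) + L (u t) + v t)) (Ici 0) t) →
      ‖u 0‖ ^ 2 + ‖v 0‖ ^ 2 + ‖W (u 0)‖ ^ 2 ≤ δ →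
      ∀ t, 0 ≤ t → ‖u t‖ ^ 2 + ‖v t‖ ^ 2 + ‖W (u t)‖ ^ 2 ≤
        C * Real.exp (-α * t) * (‖u 0‖ ^ 2 + ‖v 0‖ ^ 2 + ‖W (u 0)‖ ^ 2) := by
  obtain ⟨P, hPsymm, ε, r, hr, c₁, hc₁, c₂, hc₂, α, hα, K, hK, hbound⟩ :=
    exists_feedbackLyapunov_bounds hsymm hnonneg hker hN hN0 hmono hm hstrong hW hW0 hB0 hμ hBlow hB
  refine ⟨min (r ^ 2 / 4) (c₁ * r ^ 2 / (2 * c₂)), by positivity,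
    (1 + K ^ 2) / (c₁) * c₂, by positivity, α, by positivity, ?_⟩
  intro u v hu hv0 hv hw hstart
  have hkerv : ∀ t, 0 ≤ t → ∀ k, L k = 0 → ⟪k, v t⟫ = 0 := by
    intro t ht k hk
    have hd : ∀ s ∈ Ici (0 : ℝ), HasDerivWithinAt (fun s => ⟪k, v s⟫) 0 (Ici 0) s := by
      intro s hs
      have h := (hasDerivWithinAt_const s (Ici 0) k).inner ℝ (hv s hs)
      rwa [inner_zero_left, add_zero, ← hsymm.apply_clm, hk, inner_zero_left] at h
    rw [← hv0 k hk]
    exact constant_of_has_deriv_right_zero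
      (fun s hs => ((hd s hs.1).continuousWithinAt.mono fun x hx => hx.1))
      (fun s hs => (hd s hs.1).mono (Ici_subset_Ici.2 hs.1)) t ⟨ht, le_rfl⟩
  have hder : ∀ t, 0 ≤ t → HasDerivWithinAt (fun t => feedbackLyapunov P W B ε (u t) (v t))
      (feedbackLyapunovDeriv L P N W ε (u t) (v t)) (Ici 0) t := fun t ht =>
    hasDerivWithinAt_feedbackLyapunov hPsymm hB ε (hu t ht) (hv t ht) (hw t ht)
  have hu0 : ‖u 0‖ ^ 2 < r ^ 2 := by
    have := hstart.trans (min_le_left _ _)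
    have : 0 < r ^ 2 := by positivity
    nlinarith [sq_nonneg ‖v 0‖, sq_nonneg ‖W (u 0)‖]
  have hu0' : ‖u 0‖ < r := lt_of_pow_lt_pow_left₀ 2 hr.le hu0
  have hV0 : feedbackLyapunov P W B ε (u 0) (v 0) < c₁ * r ^ 2 := by
    have h1 := hstart.trans (min_le_right _ _)
    rw [le_div_iff₀ (by positivity)] at h1
    have h2 := ((hbound _ hu0'.le).2 (v 0)).2.1
    have h3 : 0 < c₁ * r ^ 2 := by positivity
    have h4 : 0 ≤ c₂ * ‖W (u 0)‖ ^ 2 := by positivity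
    nlinarith
  intro t ht
  obtain ⟨hut, hVt⟩ := le_exp_of_deriv_le_of_trapped (V := fun t => feedbackLyapunov P W B ε (u t) (v t))
    (q := fun t => ‖u t‖) (α := α) (c := c₁) (by positivity) hr (by positivity)
    (fun t ht => (hder t ht).continuousWithinAt) hu.norm
    (fun t ht => (hder t ht.le).hasDerivAt (Ici_mem_nhds ht))
    (fun t ht hq => ((hbound _ hq).2 _).2.2 (hkerv t ht.le))
    (fun t ht hq => le_trans (by gcongr; simp) ((hbound _ hq).2 (v t)).1) hu0' hV0 ht
  have h1 := ((hbound _ hut).2 (v t)).1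
  have h2 := ((hbound _ hu0'.le).2 (v 0)).2.1
  have hWt : ‖W (u t)‖ ^ 2 ≤ (K * ‖u t‖) ^ 2 := by gcongr; exact (hbound _ hut).1
  calc ‖u t‖ ^ 2 + ‖v t‖ ^ 2 + ‖W (u t)‖ ^ 2
      ≤ (1 + K ^ 2) * (‖u t‖ ^ 2 + ‖v t‖ ^ 2) := by
        nlinarith [mul_nonneg (sq_nonneg K) (sq_nonneg ‖v t‖)]
    _ = (1 + K ^ 2) / (c₁) * (c₁ * (‖u t‖ ^ 2 + ‖v t‖ ^ 2)) := by field_simp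
    _ ≤ (1 + K ^ 2) / (c₁) * (Real.exp (-(α) * t) *
        (c₂ * (‖u 0‖ ^ 2 + ‖v 0‖ ^ 2 + ‖W (u 0)‖ ^ 2))) := by
      refine mul_le_mul_of_nonneg_left ((h1.trans hVt).trans ?_) (by positivity)
      gcongr
      refine h2.trans (mul_le_mul_of_nonneg_left ?_ hc₂.le)
      exact le_add_of_nonneg_right (sq_nonneg _)
    _ = _ := by ring

end Hilbert

section Graph

variable {ι E : Type*} [Fintype ι] [NormedAddCommGroup E] [InnerProductSpace ℝ E]

theorem hasDerivWithinAt_piLp {v : ℝ → PiLp 2 fun _ : ι => E} {v' : PiLp 2 fun _ : ι => E}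
    {S : Set ℝ} {t : ℝ} (h : ∀ i, HasDerivWithinAt (fun s => v s i) (v' i) S t) :
    HasDerivWithinAt v v' S t := by
  rw [hasDerivWithinAt_iff_hasFDerivWithinAt, hasFDerivWithinAt_piLp]
  intro i
  refine (h i).hasFDerivWithinAt.congr_fderiv ?_
  ext
  simp

variable [FiniteDimensional ℝ E] (G : SimpleGraph ι) [DecidableRel G.Adj]

/-- The graph Laplacian acting on `E`-valued functions on the vertices. -/
noncomputable def graphLaplacian :
    (PiLp 2 fun _ : ι => E) →L[ℝ] PiLp 2 fun _ : ι => E :=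
  LinearMap.toContinuousLinearMap
    { toFun u := WithLp.toLp 2 fun i => ∑ j ∈ G.neighborFinset i, (u i - u j)
      map_add' u v := by
        ext1 i
        simp only [PiLp.add_apply, ← Finset.sum_add_distrib]
        exact Finset.sum_congr rfl fun j _ => by abel
      map_smul' c u := by
        ext1 i
        simp only [PiLp.smul_apply, RingHom.id_apply, Finset.smul_sum, smul_sub] }

variable {G}

theorem graphLaplacian_apply (u : PiLp 2 fun _ : ι => E) (i : ι) :
    graphLaplacian G u i = ∑ j ∈ G.neighborFinset i, (u i - u j) := rfl

theorem inner_graphLaplacian (u v : PiLp 2 fun _ : ι => E) :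
    ⟪graphLaplacian G u, v⟫ =
      (∑ i, ∑ j ∈ G.neighborFinset i, ⟪u i - u j, v i - v j⟫) / 2 := by
  have h1 : ⟪graphLaplacian G u, v⟫ = ∑ i, ∑ j ∈ G.neighborFinset i, ⟪u i - u j, v i⟫ := by
    simp only [PiLp.inner_apply, graphLaplacian_apply, sum_inner]
  have h2 : ∑ i, ∑ j ∈ G.neighborFinset i, ⟪u i - u j, v i⟫ =
      -∑ i, ∑ j ∈ G.neighborFinset i, ⟪u i - u j, v j⟫ := by
    rw [Finset.sum_comm' (t' := Finset.univ) (s' := fun j => G.neighborFinset j)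
      (by simp [SimpleGraph.adj_comm]), ← Finset.sum_neg_distrib]
    refine Finset.sum_congr rfl fun i _ => ?_
    rw [← Finset.sum_neg_distrib]
    exact Finset.sum_congr rfl fun j _ => by rw [← inner_neg_left, neg_sub]
  simp only [inner_sub_right (𝕜 := ℝ) (_ - _), Finset.sum_sub_distrib]
  linarith

theorem graphLaplacian_isSymmetric :
    ((graphLaplacian G : (PiLp 2 fun _ : ι => E) →L[ℝ] PiLp 2 fun _ : ι => E) :
      (PiLp 2 fun _ : ι => E) →ₗ[ℝ] PiLp 2 fun _ : ι => E).IsSymmetric := by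
  intro u v
  change ⟪graphLaplacian G u, v⟫ = ⟪u, graphLaplacian G v⟫
  rw [real_inner_comm _ u, inner_graphLaplacian, inner_graphLaplacian]
  simp only [real_inner_comm]

theorem inner_graphLaplacian_self_nonneg (u : PiLp 2 fun _ : ι => E) :
    0 ≤ ⟪graphLaplacian G u, u⟫ := by
  rw [inner_graphLaplacian]
  have : 0 ≤ ∑ i, ∑ j ∈ G.neighborFinset i, ⟪u i - u j, u i - u j⟫ :=
    Finset.sum_nonneg fun i _ => Finset.sum_nonneg fun j _ => real_inner_self_nonneg
  positivity

theorem eq_of_adj_of_inner_graphLaplacian_self_eq_zero {u : PiLp 2 fun _ : ι => E}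
    (hu : ⟪graphLaplacian G u, u⟫ = 0) {i j : ι} (hij : G.Adj i j) : u i = u j := by
  rw [inner_graphLaplacian, div_eq_zero_iff, or_iff_left two_ne_zero,
    Finset.sum_eq_zero_iff_of_nonneg
      fun i _ => Finset.sum_nonneg fun j _ => real_inner_self_nonneg] at hu
  have h := hu i (Finset.mem_univ i)
  rw [Finset.sum_eq_zero_iff_of_nonneg fun j _ => real_inner_self_nonneg] at h
  exact sub_eq_zero.1 (inner_self_eq_zero.1 (h j (by simpa using hij)))

theorem graphLaplacian_eq_zero_of_inner_self_eq_zero (u : PiLp 2 fun _ : ι => E)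
    (hu : ⟪graphLaplacian G u, u⟫ = 0) : graphLaplacian G u = 0 := by
  ext1 i
  rw [graphLaplacian_apply, PiLp.zero_apply]
  refine Finset.sum_eq_zero fun j hj => sub_eq_zero.2 ?_
  exact eq_of_adj_of_inner_graphLaplacian_self_eq_zero hu (by simpa using hj)

theorem eq_of_graphLaplacian_eq_zero (hG : G.Connected) {u : PiLp 2 fun _ : ι => E}
    (hu : graphLaplacian G u = 0) (i j : ι) : u i = u j := by
  obtain ⟨p⟩ := hG.preconnected i j
  induction p with
  | nil => rfl
  | cons hadj _ ih =>
    exact (eq_of_adj_of_inner_graphLaplacian_self_eq_zero (by rw [hu, inner_zero_left]) hadj).trans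
      ih

theorem inner_eq_zero_of_graphLaplacian_eq_zero (hG : G.Connected) {u v : PiLp 2 fun _ : ι => E}
    (hu : graphLaplacian G u = 0) (hv : ∑ i, v i = 0) : ⟪u, v⟫ = 0 := by
  obtain ⟨i₀⟩ := hG.nonempty
  rw [PiLp.inner_apply]
  simp only [eq_of_graphLaplacian_eq_zero hG hu _ i₀]
  rw [← inner_sum, hv, inner_zero_right]

end Graph

section Gradient

variable {ι E : Type*} [NormedAddCommGroup E] [InnerProductSpace ℝ E] [CompleteSpace E]

theorem ContDiffAt.differentiableAt_gradient {f : E → ℝ} {x : E} (hf : ContDiffAt ℝ 2 f x) :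
    DifferentiableAt ℝ (gradient f) x :=
  (InnerProductSpace.toDual ℝ E).symm.differentiableAt.comp x
    ((hf.fderiv_right (m := 1) (by norm_num)).differentiableAt one_ne_zero)

theorem gradient_fun_sum [Fintype ι] {f : ι → E → ℝ} {x : E} (hf : ∀ i, DifferentiableAt ℝ (f i) x) :
    gradient (fun x => ∑ i, f i x) x = ∑ i, gradient (f i) x := by
  simp only [gradient, fderiv_fun_sum fun i _ => hf i, map_sum]

/-- The map `u ↦ (∇ fᵢ (x + uᵢ) - ∇ fᵢ x)ᵢ`. -/
noncomputable def gradientIncrement (f : ι → E → ℝ) (x : E) (u : PiLp 2 fun _ : ι => E) :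
    PiLp 2 fun _ : ι => E :=
  WithLp.toLp 2 fun i => gradient (f i) (x + u i) - gradient (f i) x

theorem gradientIncrement_apply (f : ι → E → ℝ) (x : E) (u : PiLp 2 fun _ : ι => E) (i : ι) :
    gradientIncrement f x u i = gradient (f i) (x + u i) - gradient (f i) x := rfl

theorem gradientIncrement_zero (f : ι → E → ℝ) (x : E) : gradientIncrement f x 0 = 0 := by
  ext1 i
  simp [gradientIncrement_apply]

variable [Fintype ι]

theorem differentiableAt_gradientIncrement {f : ι → E → ℝ} {x : E}
    (hf : ∀ i, ContDiffAt ℝ 2 (f i) x) : DifferentiableAt ℝ (gradientIncrement f x) 0 := by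
  rw [differentiableAt_piLp]
  intro i
  refine DifferentiableAt.sub_const ?_ _
  have h1 : DifferentiableAt ℝ (fun u : PiLp 2 fun _ : ι => E => x + u i) 0 :=
    (PiLp.hasFDerivAt_apply 2 (0 : PiLp 2 fun _ : ι => E) i).differentiableAt.const_add x
  exact DifferentiableAt.comp (g := gradient (f i)) (0 : PiLp 2 fun _ : ι => E)
    (by simpa using (hf i).differentiableAt_gradient) h1

theorem inner_gradientIncrement_self_nonneg {f : ι → E → ℝ} (hconv : ∀ i, ConvexOn ℝ univ (f i))
    (hdiff : ∀ i x, DifferentiableAt ℝ (f i) x) (x : E) (u : PiLp 2 fun _ : ι => E) :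
    0 ≤ ⟪gradientIncrement f x u, u⟫ := by
  rw [PiLp.inner_apply]
  refine Finset.sum_nonneg fun i _ => ?_
  have h : ConvexOn ℝ univ fun x => f i x - 0 / 2 * ‖x‖ ^ 2 := by simpa using hconv i
  simpa [gradientIncrement_apply] using
    h.mul_norm_sq_le_inner_gradient_sub (hdiff i x) (hdiff i (x + u i))

theorem mul_norm_sq_le_inner_gradientIncrement_of_eq [Nonempty ι] {f : ι → E → ℝ}
    (hdiff : ∀ i x, DifferentiableAt ℝ (f i) x) {σ : ℝ}
    (hstrong : ConvexOn ℝ univ fun x => (∑ i, f i x) - σ / 2 * ‖x‖ ^ 2) (x : E)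
    {u : PiLp 2 fun _ : ι => E} (hu : ∀ i j, u i = u j) :
    σ / Fintype.card ι * ‖u‖ ^ 2 ≤ ⟪gradientIncrement f x u, u⟫ := by
  obtain ⟨i₀⟩ := ‹Nonempty ι›
  have hd : ∀ x, DifferentiableAt ℝ (fun x => ∑ i, f i x) x := fun x => by
    exact DifferentiableAt.fun_sum fun i _ => hdiff i x
  have h := hstrong.mul_norm_sq_le_inner_gradient_sub (hd x) (hd (x + u i₀))
  have hcard : (Fintype.card ι : ℝ) ≠ 0 := by exact_mod_cast (Fintype.card_pos_iff.2 ⟨i₀⟩).ne'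
  rw [gradient_fun_sum fun i => hdiff i _, gradient_fun_sum fun i => hdiff i _,
    ← Finset.sum_sub_distrib, sum_inner, add_sub_cancel_left] at h
  rw [PiLp.inner_apply, PiLp.norm_sq_eq_of_L2]
  simp only [gradientIncrement_apply, hu _ i₀, Finset.sum_const, Finset.card_univ, nsmul_eq_mul]
  convert h using 1
  field_simp

/-- The sum over `i` of the Bregman divergences of `φ` from `x + uᵢ` to `x`. -/
noncomputable def sumBregman (φ : E → ℝ) (x : E) (u : PiLp 2 fun _ : ι => E) : ℝ :=
  ∑ i, (φ x - φ (x + u i) + ⟪gradient φ (x + u i), u i⟫)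

theorem sumBregman_zero (φ : E → ℝ) (x : E) :
    sumBregman φ x (0 : PiLp 2 fun _ : ι => E) = 0 := by
  simp [sumBregman]

variable {φ : E → ℝ} {μ : ℝ}

theorem mul_norm_sq_le_sumBregman (hstrong : ConvexOn ℝ univ fun x => φ x - μ / 2 * ‖x‖ ^ 2)
    (hdiff : ∀ x, DifferentiableAt ℝ φ x) (x : E) (u : PiLp 2 fun _ : ι => E) :
    μ / 2 * ‖u‖ ^ 2 ≤ sumBregman φ x u := by
  rw [PiLp.norm_sq_eq_of_L2, Finset.mul_sum]
  refine Finset.sum_le_sum fun i _ => ?_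
  have h := hstrong.add_inner_gradient_add_le (hdiff (x + u i)) x
  rw [sub_add_cancel_left, inner_neg_right, norm_neg] at h
  linarith

theorem inner_gradientIncrement_sub_le_sumBregman_sub
    (hstrong : ConvexOn ℝ univ fun x => φ x - μ / 2 * ‖x‖ ^ 2) (hμ : 0 ≤ μ)
    (hdiff : ∀ x, DifferentiableAt ℝ φ x) (x : E) (a b : PiLp 2 fun _ : ι => E) :
    ⟪gradientIncrement (fun _ => φ) x a - gradientIncrement (fun _ => φ) x b, b⟫ ≤
      sumBregman φ x a - sumBregman φ x b := by
  rw [PiLp.inner_apply, sumBregman, sumBregman, ← Finset.sum_sub_distrib]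
  refine Finset.sum_le_sum fun i _ => ?_
  have h := hstrong.add_inner_gradient_add_le (hdiff (x + a i)) (x + b i)
  have h' : 0 ≤ μ / 2 * ‖x + b i - (x + a i)‖ ^ 2 := by positivity
  rw [add_sub_add_left_eq_sub] at h h'
  simp only [PiLp.sub_apply, gradientIncrement_apply, inner_sub_left, inner_sub_right] at h ⊢
  linarith

end Gradient

end Helpers

/-- Local exponential convergence of continuous-time distributed mirror descent
with integral feedback (main result of the paper). -/
theorem dmd_integral_feedback_local_exponential_convergence
    (n d : ℕ) (G : SimpleGraph (Fin n)) [DecidableRel G.Adj]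
    (hconn : G.Connected)
    (f : Fin n → EuclideanSpace ℝ (Fin d) → ℝ)
    (hfconv : ∀ i, ConvexOn ℝ Set.univ (f i))
    (hfdiff : ∀ i x, DifferentiableAt ℝ (f i) x)
    (σ : ℝ) (hσ : 0 < σ)
    (hFstrong : ConvexOn ℝ Set.univ
      (fun x : EuclideanSpace ℝ (Fin d) => (∑ i, f i x) - σ / 2 * ‖x‖ ^ 2))
    (xstar : EuclideanSpace ℝ (Fin d))
    (hmin : ∀ w, (∑ i, f i xstar) ≤ ∑ i, f i w)
    (huniq : ∀ w, (∀ w', (∑ i, f i w) ≤ ∑ i, f i w') → w = xstar)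
    (hfsmooth : ∀ i, ContDiffAt ℝ 2 (f i) xstar)
    (φ : EuclideanSpace ℝ (Fin d) → ℝ)
    (hφdiff : ∀ x, DifferentiableAt ℝ φ x)
    (μ : ℝ) (hμ : 0 < μ)
    (hφstrong : ConvexOn ℝ Set.univ
      (fun x : EuclideanSpace ℝ (Fin d) => φ x - μ / 2 * ‖x‖ ^ 2))
    (hφsmooth : ContDiffAt ℝ 3 φ xstar) :
    ∃ δ > (0 : ℝ), ∃ C > (0 : ℝ), ∃ α > (0 : ℝ),
      ∀ x y z : Fin n → ℝ → EuclideanSpace ℝ (Fin d),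
        (∀ i, ∀ t : ℝ, 0 ≤ t → z i t = gradient φ (x i t)) →
        (∀ i, ContinuousOn (x i) (Set.Ici 0)) →
        (∑ i, y i 0) = 0 →
        (∀ i, ∀ t : ℝ, 0 ≤ t →
          HasDerivWithinAt (y i) (∑ j ∈ G.neighborFinset i, (x i t - x j t))
            (Set.Ici 0) t) →
        (∀ i, ∀ t : ℝ, 0 ≤ t →
          HasDerivWithinAt (z i)
            (-(gradient (f i) (x i t)
                + (∑ j ∈ G.neighborFinset i, (x i t - x j t)) + y i t))
            (Set.Ici 0) t) →
        Real.sqrt (∑ i, (‖x i 0 - xstar‖ ^ 2 + ‖y i 0 + gradient (f i) xstar‖ ^ 2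
            + ‖z i 0 - gradient φ xstar‖ ^ 2)) ≤ δ →
        ∀ t : ℝ, 0 ≤ t →
          Real.sqrt (∑ i, (‖x i t - xstar‖ ^ 2 + ‖y i t + gradient (f i) xstar‖ ^ 2
              + ‖z i t - gradient φ xstar‖ ^ 2))
            ≤ C * Real.exp (-α * t) *
              Real.sqrt (∑ i, (‖x i 0 - xstar‖ ^ 2 + ‖y i 0 + gradient (f i) xstar‖ ^ 2
                + ‖z i 0 - gradient φ xstar‖ ^ 2)) := by
  have : Nonempty (Fin n) := hconn.nonempty
  have hcard : (0 : ℝ) < Fintype.card (Fin n) := by exact_mod_cast Fintype.card_pos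
  have hstar : ∑ i, gradient (f i) xstar = 0 := by
    have hloc : IsLocalMin (fun x => ∑ i, f i x) xstar := .of_forall hmin
    rw [← gradient_fun_sum fun i => hfdiff i xstar, gradient, hloc.fderiv_eq_zero, map_zero]
  obtain ⟨δ, hδ, C, hC, α, hα, hmain⟩ := exists_exponential_decay_of_integral_feedback
    (L := graphLaplacian G) (N := gradientIncrement f xstar)
    (W := gradientIncrement (fun _ => φ) xstar) (B := sumBregman φ xstar)
    graphLaplacian_isSymmetric inner_graphLaplacian_self_nonneg
    graphLaplacian_eq_zero_of_inner_self_eq_zero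
    (differentiableAt_gradientIncrement hfsmooth) (gradientIncrement_zero f xstar)
    (inner_gradientIncrement_self_nonneg hfconv hfdiff xstar) (div_pos hσ hcard)
    (fun u hu => mul_norm_sq_le_inner_gradientIncrement_of_eq hfdiff hFstrong xstar
      (eq_of_graphLaplacian_eq_zero hconn hu))
    (differentiableAt_gradientIncrement fun _ => hφsmooth.of_le (by norm_num))
    (gradientIncrement_zero _ xstar) (sumBregman_zero φ xstar) (half_pos hμ)
    (mul_norm_sq_le_sumBregman hφstrong hφdiff xstar)
    (inner_gradientIncrement_sub_le_sumBregman_sub hφstrong hμ.le hφdiff xstar)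
  refine ⟨√δ, by positivity, √C, by positivity, α / 2, by positivity, ?_⟩
  intro x y z hz hx hy0 hy hzd hstart t ht
  let u : ℝ → PiLp 2 fun _ : Fin n => EuclideanSpace ℝ (Fin d) :=
    fun t => WithLp.toLp 2 fun i => x i t - xstar
  let v : ℝ → PiLp 2 fun _ : Fin n => EuclideanSpace ℝ (Fin d) :=
    fun t => WithLp.toLp 2 fun i => y i t + gradient (f i) xstar
  have hW : ∀ t, 0 ≤ t → ∀ i,
      gradientIncrement (fun _ => φ) xstar (u t) i = z i t - gradient φ xstar := by
    intro t ht i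
    simp [gradientIncrement_apply, u, hz i t ht]
  have hsum : ∀ t, 0 ≤ t → ∑ i, (‖x i t - xstar‖ ^ 2 + ‖y i t + gradient (f i) xstar‖ ^ 2
      + ‖z i t - gradient φ xstar‖ ^ 2) =
      ‖u t‖ ^ 2 + ‖v t‖ ^ 2 + ‖gradientIncrement (fun _ => φ) xstar (u t)‖ ^ 2 := by
    intro t ht
    simp only [PiLp.norm_sq_eq_of_L2, hW t ht, Finset.sum_add_distrib, u, v]
  rw [hsum 0 le_rfl] at hstart ⊢
  rw [hsum t ht]
  have hdecay := hmain u v ?_ ?_ ?_ ?_ ((Real.sqrt_le_sqrt_iff hδ.le).1 hstart) t ht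
  · calc _ ≤ √(C * Real.exp (-α * t) * (‖u 0‖ ^ 2 + ‖v 0‖ ^ 2 +
          ‖gradientIncrement (fun _ => φ) xstar (u 0)‖ ^ 2)) := Real.sqrt_le_sqrt hdecay
      _ = _ := by
        rw [Real.sqrt_mul (by positivity), Real.sqrt_mul hC.le, ← Real.exp_half]
        congr 3
        ring
  · exact (PiLp.continuous_toLp 2 _).comp_continuousOn
      (continuousOn_pi.2 fun i => (hx i).sub continuousOn_const)
  · intro k hk
    exact inner_eq_zero_of_graphLaplacian_eq_zero hconn hk
      (by simp only [v, Finset.sum_add_distrib, hy0, hstar, add_zero])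
  · intro t ht
    refine hasDerivWithinAt_piLp fun i => ?_
    simpa [graphLaplacian_apply, u, v] using (hy i t ht).add_const (gradient (f i) xstar)
  · intro t ht
    refine hasDerivWithinAt_piLp fun i => ?_
    refine (((hzd i t ht).sub_const (gradient φ xstar)).congr (fun s hs => hW s hs i)
      (hW t ht i)).congr_deriv ?_
    simp only [PiLp.neg_apply, PiLp.add_apply, gradientIncrement_apply, graphLaplacian_apply, u, v,
      add_sub_cancel, sub_sub_sub_cancel_right]
    abel
end

section
/- Let G be a connected simple undirected graph on n vertices with Laplacian matrix 𝓛 ∈ ℝ^{n×n}, and let L = 𝓛 ⊗ I_d ∈ ℝ^{nd×nd} be the Kronecker product of 𝓛 with the d×d identity matrix. Let H_1,…,H_n ∈ ℝ^{d×d} be symmetric positive semidefinite matrices such that Σ_{i=1}^n H_i is positive definite, and let H ∈ ℝ^{nd×nd} be the block-diagonal matrix with diagonal blocks H_1,…,H_n. Then the symmetric matrix H + L is positive definite. -/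
open scoped BigOperators Kronecker

open Matrix

section

variable {V m R : Type*} [Fintype V] [DecidableEq V] [Fintype m] [CommRing R]

theorem dotProduct_blockDiag_mulVec (H : V → Matrix m m R) (x : V × m → R) :
    x ⬝ᵥ (Matrix.of (fun p q : V × m => if p.1 = q.1 then H p.1 p.2 q.2 else 0) *ᵥ x) =
      ∑ i, (fun a => x (i, a)) ⬝ᵥ (H i *ᵥ fun a => x (i, a)) := by
  simp only [dotProduct, mulVec, Fintype.sum_prod_type, of_apply, ite_mul, zero_mul]
  refine Finset.sum_congr rfl fun i _ => Finset.sum_congr rfl fun a _ => ?_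
  congr 1
  rw [Finset.sum_comm]
  simp

omit [DecidableEq V] in
theorem dotProduct_kronecker_one_mulVec [DecidableEq m] (A : Matrix V V R) (x : V × m → R) :
    x ⬝ᵥ ((A ⊗ₖ (1 : Matrix m m R)) *ᵥ x) =
      ∑ a, (fun i => x (i, a)) ⬝ᵥ (A *ᵥ fun i => x (i, a)) := by
  simp only [dotProduct, mulVec, Fintype.sum_prod_type, kroneckerMap_apply, one_apply, mul_ite,
    mul_one, mul_zero, ite_mul, zero_mul, Finset.sum_ite_eq, Finset.mem_univ, if_true]
  exact Finset.sum_comm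

omit [Fintype V] [Fintype m] in
theorem isHermitian_blockDiag [StarRing R] {H : V → Matrix m m R} (hH : ∀ i, (H i).IsHermitian) :
    (Matrix.of fun p q : V × m => if p.1 = q.1 then H p.1 p.2 q.2 else 0).IsHermitian := by
  ext ⟨i, a⟩ ⟨j, b⟩
  by_cases h : j = i
  · subst h
    simpa using (hH j).apply a b
  · simp [h, Ne.symm h]

end

/-- Lemma 1 of the paper: if each block `H i` is symmetric positive semidefinite,
their sum is positive definite, and `L` is the Kronecker product of the Laplacian
of a connected graph with the identity, then the block-diagonal matrix with blocks
`H i` plus `L` is positive definite. -/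
theorem blockDiag_add_laplacian_kron_posDef
    (n d : ℕ) (G : SimpleGraph (Fin n)) [DecidableRel G.Adj]
    (hconn : G.Connected)
    (H : Fin n → Matrix (Fin d) (Fin d) ℝ)
    (hH : ∀ i, (H i).PosSemidef)
    (hsum : (∑ i, H i).PosDef) :
    (Matrix.of (fun p q : Fin n × Fin d =>
        if p.1 = q.1 then H p.1 p.2 q.2 else 0)
      + (G.lapMatrix ℝ) ⊗ₖ (1 : Matrix (Fin d) (Fin d) ℝ)).PosDef := by
  have hL := G.posSemidef_lapMatrix ℝ
  refine .of_dotProduct_mulVec_pos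
    ((isHermitian_blockDiag fun i => (hH i).isHermitian).add
      (hL.kronecker PosSemidef.one).isHermitian) fun x hx => ?_
  rw [star_trivial, add_mulVec, dotProduct_add, dotProduct_blockDiag_mulVec,
    dotProduct_kronecker_one_mulVec]
  have hblock (i : Fin n) : 0 ≤ (fun a => x (i, a)) ⬝ᵥ (H i *ᵥ fun a => x (i, a)) := by
    simpa using (hH i).dotProduct_mulVec_nonneg fun a => x (i, a)
  have hlap (a : Fin d) : 0 ≤ (fun i => x (i, a)) ⬝ᵥ (G.lapMatrix ℝ *ᵥ fun i => x (i, a)) := by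
    simpa using hL.dotProduct_mulVec_nonneg fun i => x (i, a)
  have hblockSum := Finset.sum_nonneg fun i (_ : i ∈ Finset.univ) => hblock i
  by_cases hzero : ∀ a, (fun i => x (i, a)) ⬝ᵥ (G.lapMatrix ℝ *ᵥ fun i => x (i, a)) = 0
  · have hconst (i j : Fin n) (a : Fin d) : x (i, a) = x (j, a) := by
      have h := hzero a
      rw [← toLinearMap₂'_apply',
        G.lapMatrix_toLinearMap₂'_apply'_eq_zero_iff_forall_reachable] at h
      exact h i j (hconn.preconnected i j)
    obtain ⟨i₀⟩ := hconn.nonempty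
    have hy : (fun a => x (i₀, a)) ≠ 0 := fun h =>
      hx <| funext fun p => (hconst p.1 i₀ p.2).trans (congrFun h p.2)
    have hpos := hsum.dotProduct_mulVec_pos hy
    rw [star_trivial, sum_mulVec, dotProduct_sum] at hpos
    rw [Finset.sum_eq_zero fun a _ => hzero a, add_zero]
    simpa only [hconst _ i₀] using hpos
  · obtain ⟨a, ha⟩ := not_forall.mp hzero
    exact add_pos_of_nonneg_of_pos hblockSum <| Finset.sum_pos'
      (fun b _ => hlap b) ⟨a, Finset.mem_univ a, (hlap a).lt_of_ne' ha⟩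
end

section
/- Let N, m be positive integers, and let D, H, L, S ∈ ℝ^{N×N} and R ∈ ℝ^{N×m} satisfy: D is symmetric positive definite; H is symmetric positive semidefinite; L is symmetric positive semidefinite; H + L is positive definite; S is symmetric; S R Rᵀ S = L; and Rᵀ S S R ∈ ℝ^{m×m} is positive definite. Let M ∈ ℝ^{(N+m)×(N+m)} be the block matrix M = [[D(H+L), D S R], [−Rᵀ S, 0]]. Then every eigenvalue λ ∈ ℂ of M satisfies Re λ > 0. -/
open scoped Matrix

open scoped ComplexOrder MatrixOrder Matrix.Norms.L2Operator in
/-- A real positive definite matrix stays positive definite over `ℂ`. -/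
theorem Matrix.PosDef.map_ofReal {n : Type*} [Fintype n] [DecidableEq n] {P : Matrix n n ℝ}
    (hP : P.PosDef) : (P.map Complex.ofReal).PosDef := by
  obtain ⟨B, hB, rfl⟩ :=
    CStarAlgebra.isStrictlyPositive_iff_eq_star_mul_self.mp hP.isStrictlyPositive
  have hU : IsUnit (B.map Complex.ofReal) := hB.map (Complex.ofRealHom.mapMatrix (m := n))
  have h := (Matrix.IsUnit.posDef_star_left_conjugate_iff (x := (1 : Matrix n n ℂ)) hU).mpr .one
  have hstar : (star B).map Complex.ofReal = star (B.map Complex.ofReal) := by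
    ext i j
    simp [Matrix.star_apply]
  have hmul : (star B * B).map Complex.ofReal
      = (star B).map Complex.ofReal * B.map Complex.ofReal :=
    Matrix.map_mul (f := Complex.ofRealHom)
  rwa [hmul, hstar, ← mul_one (star (B.map Complex.ofReal))]

open scoped ComplexOrder in
/-- The generalized eigenvalue problem `A x + K y = lam E x`, `-Kᴴ x = lam y` with `A`, `E`
positive definite and `K` injective has only eigenvalues of positive real part. -/
theorem re_pos_of_saddlePoint_eigenpair {n m : Type*} [Fintype n] [Fintype m]
    {A E : Matrix n n ℂ} {K : Matrix n m ℂ} (hA : A.PosDef) (hE : E.PosDef)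
    (hK : ∀ y, K *ᵥ y = 0 → y = 0) {lam : ℂ} {x : n → ℂ} {y : m → ℂ}
    (hxy : x = 0 → y ≠ 0) (hx : A *ᵥ x + K *ᵥ y = lam • (E *ᵥ x))
    (hy : -(Kᴴ *ᵥ x) = lam • y) : 0 < lam.re := by
  have hx0 : x ≠ 0 := by
    rintro rfl
    exact hxy rfl (hK y (by simpa using hx))
  have h1 : star x ⬝ᵥ (A *ᵥ x) + star x ⬝ᵥ (K *ᵥ y) = lam * (star x ⬝ᵥ (E *ᵥ x)) := by
    rw [← dotProduct_add, hx, dotProduct_smul, smul_eq_mul]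
  have h2 : -(star x ⬝ᵥ (K *ᵥ y)) = star lam * (star y ⬝ᵥ y) := by
    have h := congrArg (fun z => star z ⬝ᵥ y) hy
    simpa [Matrix.star_mulVec, ← Matrix.dotProduct_mulVec] using h
  have h3 : star x ⬝ᵥ (A *ᵥ x) = lam * (star x ⬝ᵥ (E *ᵥ x)) + star lam * (star y ⬝ᵥ y) := by
    rw [← h1, ← h2]; ring
  have hA' := Complex.pos_iff.mp (hA.dotProduct_mulVec_pos hx0)
  have hE' := Complex.pos_iff.mp (hE.dotProduct_mulVec_pos hx0)
  have hy' := Complex.nonneg_iff.mp (dotProduct_star_self_nonneg y)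
  have h4 := congrArg Complex.re h3
  simp only [Complex.add_re, Complex.mul_re, ← hE'.2, ← hy'.2, mul_zero, sub_zero,
    Complex.star_def, Complex.conj_re, ← mul_add] at h4
  exact pos_of_mul_pos_left (h4.subst hA'.1) (add_nonneg hE'.1.le hy'.1)

/-- Lemma 2 of the paper: every eigenvalue of the block matrix
`M = [[D(H+L), DSR], [-RᵀS, 0]]` has positive real part. -/
theorem eigenvalues_pos_real_part
    (N m : ℕ) (hN : 0 < N) (hm : 0 < m)
    (D H L S : Matrix (Fin N) (Fin N) ℝ) (R : Matrix (Fin N) (Fin m) ℝ)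
    (hD : D.PosDef) (hH : H.PosSemidef) (hL : L.PosSemidef)
    (hHL : (H + L).PosDef) (hS : S.IsSymm)
    (hSR : S * R * Rᵀ * S = L)
    (hRS : (Rᵀ * S * S * R).PosDef)
    (M : Matrix (Fin N ⊕ Fin m) (Fin N ⊕ Fin m) ℝ)
    (hM : M = Matrix.fromBlocks (D * (H + L)) (D * S * R) (-(Rᵀ * S)) 0)
    (lam : ℂ)
    (hlam : (M.map (Complex.ofReal) - lam • (1 : Matrix (Fin N ⊕ Fin m) (Fin N ⊕ Fin m) ℂ)).det = 0) :
    0 < lam.re := by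
  have hmul {a b c : ℕ} (P : Matrix (Fin a) (Fin b) ℝ) (Q : Matrix (Fin b) (Fin c) ℝ) :
      (P * Q).map Complex.ofReal = P.map Complex.ofReal * Q.map Complex.ofReal :=
    Matrix.map_mul (f := Complex.ofRealHom)
  have hinv : D⁻¹ * D = 1 := Matrix.nonsing_inv_mul D ((Matrix.isUnit_iff_isUnit_det D).mp hD.isUnit)
  have hinvC : D⁻¹.map Complex.ofReal * D.map Complex.ofReal = 1 := by
    rw [← hmul, hinv]
    exact Matrix.map_one _ Complex.ofReal_zero Complex.ofReal_one
  have hKH : ((S * R).map Complex.ofReal)ᴴ = (Rᵀ * S).map Complex.ofReal := by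
    have hT : Rᵀ * S = (S * R)ᵀ := by rw [Matrix.transpose_mul, hS.eq]
    rw [hT]
    ext i j
    exact Complex.conj_ofReal _
  have hK (y : Fin m → ℂ) (hy : (S * R).map Complex.ofReal *ᵥ y = 0) : y = 0 := by
    have hG : IsUnit ((Rᵀ * S * S * R).map Complex.ofReal) := by
      open scoped ComplexOrder in exact hRS.map_ofReal.isUnit
    rw [Matrix.mul_assoc (Rᵀ * S), hmul] at hG
    apply Matrix.mulVec_injective_of_isUnit hG
    simp only [← Matrix.mulVec_mulVec, hy, Matrix.mulVec_zero]
  obtain ⟨v, hv, hMv⟩ := Matrix.exists_mulVec_eq_zero_iff.mpr hlam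
  obtain ⟨x, y, rfl⟩ : ∃ x y, v = Sum.elim x y :=
    ⟨v ∘ Sum.inl, v ∘ Sum.inr, (Sum.elim_comp_inl_inr v).symm⟩
  rw [Matrix.sub_mulVec, Matrix.smul_mulVec, Matrix.one_mulVec, sub_eq_zero, hM,
    Matrix.fromBlocks_map, Matrix.fromBlocks_mulVec] at hMv
  have hx := congrArg (fun w => w ∘ Sum.inl) hMv
  have hy := congrArg (fun w => w ∘ Sum.inr) hMv
  refine re_pos_of_saddlePoint_eigenpair (x := x) (y := y) hHL.map_ofReal hD.inv.map_ofReal hK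
    ?_ ?_ ?_
  · rintro rfl rfl
    exact hv (by ext (i | i) <;> rfl)
  · have hx' : (D * (H + L)).map Complex.ofReal *ᵥ x + (D * S * R).map Complex.ofReal *ᵥ y
        = lam • x := hx
    rw [← Matrix.mulVec_smul, ← hx', Matrix.mul_assoc D, hmul D, hmul D, Matrix.mulVec_add,
      Matrix.mulVec_mulVec, Matrix.mulVec_mulVec, ← Matrix.mul_assoc, ← Matrix.mul_assoc,
      hinvC, Matrix.one_mul, Matrix.one_mul]
  · have hy' : (-(Rᵀ * S)).map Complex.ofReal *ᵥ x
        + (0 : Matrix (Fin m) (Fin m) ℝ).map Complex.ofReal *ᵥ y = lam • y := hy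
    have hneg : (-(Rᵀ * S)).map Complex.ofReal = -((Rᵀ * S).map Complex.ofReal) := by
      ext i j
      exact Complex.ofReal_neg _
    rw [hneg, Matrix.map_zero _ Complex.ofReal_zero, Matrix.zero_mulVec, add_zero,
      Matrix.neg_mulVec] at hy'
    rwa [hKH]
end

section
/- Let N, m be positive integers, and let D, H, L, S ∈ ℝ^{N×N} and R ∈ ℝ^{N×m} satisfy: D is symmetric positive definite; H is symmetric positive semidefinite; L is symmetric positive semidefinite; H + L is positive definite; S is symmetric; S R Rᵀ S = L; and Rᵀ S S R ∈ ℝ^{m×m} is positive definite. Let M ∈ ℝ^{(N+m)×(N+m)} be the block matrix M = [[D(H+L), D S R], [−Rᵀ S, 0]]. Then det(M) > 0; in particular M is invertible and 0 is not an eigenvalue of M. -/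
open scoped Matrix

/-- A skew-coupled block matrix whose diagonal is a positive definite block and zero, and whose
coupling block `B` is injective, has positive determinant. -/
theorem Matrix.PosDef.det_fromBlocks_neg_transpose_zero_pos
    {n m : Type*} [Fintype n] [DecidableEq n] [Fintype m] [DecidableEq m]
    {A : Matrix n n ℝ} (hA : A.PosDef) {B : Matrix n m ℝ}
    (hB : Function.Injective B.mulVec) :
    0 < (Matrix.fromBlocks A B (-Bᵀ) 0).det := by
  let : Invertible A := hA.isUnit.invertible
  rw [Matrix.det_fromBlocks₁₁]
  refine mul_pos hA.det_pos ?_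
  have h := (hA.inv.conjTranspose_mul_mul_same hB).det_pos
  simpa [Matrix.invOf_eq_nonsing_inv, Matrix.conjTranspose_eq_transpose_of_trivial] using h

/-- A matrix with positive definite Gram matrix acts injectively. -/
theorem Matrix.mulVec_injective_of_posDef_transpose_mul_self
    {n m : Type*} [Fintype n] [Fintype m] [DecidableEq m] {B : Matrix n m ℝ}
    (hB : (Bᵀ * B).PosDef) : Function.Injective B.mulVec := by
  intro x y hxy
  refine Matrix.mulVec_injective_of_isUnit hB.isUnit ?_
  simp only [← Matrix.mulVec_mulVec, hxy]

/-- The block matrix `M = [[D(H+L), DSR], [-RᵀS, 0]]` has positive determinant;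
in particular it is invertible and `0` is not an eigenvalue of `M`. -/
theorem block_matrix_det_pos
    (N m : ℕ) (hN : 0 < N) (hm : 0 < m)
    (D H L S : Matrix (Fin N) (Fin N) ℝ) (R : Matrix (Fin N) (Fin m) ℝ)
    (hD : D.PosDef) (hH : H.PosSemidef) (hL : L.PosSemidef)
    (hHL : (H + L).PosDef) (hS : S.IsSymm)
    (hSR : S * R * Rᵀ * S = L)
    (hRS : (Rᵀ * S * S * R).PosDef)
    (M : Matrix (Fin N ⊕ Fin m) (Fin N ⊕ Fin m) ℝ)
    (hM : M = Matrix.fromBlocks (D * (H + L)) (D * S * R) (-(Rᵀ * S)) 0) :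
    0 < M.det ∧ IsUnit M ∧
      (M.map (Complex.ofReal)
        - (0 : ℂ) • (1 : Matrix (Fin N ⊕ Fin m) (Fin N ⊕ Fin m) ℂ)).det ≠ 0 := by
  have hT : (S * R)ᵀ = Rᵀ * S := by rw [Matrix.transpose_mul, hS.eq]
  have hinj : Function.Injective (S * R).mulVec :=
    Matrix.mulVec_injective_of_posDef_transpose_mul_self (by
      simpa only [hT, Matrix.mul_assoc] using hRS)
  have hfac : M = Matrix.fromBlocks D 0 0 1 *
      Matrix.fromBlocks (H + L) (S * R) (-(S * R)ᵀ) 0 := by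
    simp [hM, hT, Matrix.fromBlocks_multiply, Matrix.mul_assoc]
  have hdet : 0 < M.det := by
    rw [hfac, Matrix.det_mul, Matrix.det_fromBlocks_zero₂₁, Matrix.det_one, mul_one]
    exact mul_pos hD.det_pos (hHL.det_fromBlocks_neg_transpose_zero_pos hinj)
  refine ⟨hdet, (Matrix.isUnit_iff_isUnit_det M).2 hdet.ne'.isUnit, ?_⟩
  have hmap : (M.map Complex.ofReal).det = (M.det : ℂ) :=
    (Complex.ofRealHom.map_det M).symm
  rw [zero_smul, sub_zero, hmap]
  exact_mod_cast hdet.ne'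
end

section
/- Let N, m be positive integers, and let D, H, L, S ∈ ℝ^{N×N} and R ∈ ℝ^{N×m} with D invertible, S symmetric, and S R Rᵀ S = L. Let M ∈ ℝ^{(N+m)×(N+m)} be the block matrix M = [[D(H+L), D S R], [−Rᵀ S, 0]], regarded as a complex matrix. Then for every λ ∈ ℂ with λ ≠ 0, det(M − λ I_{N+m}) = (−λ)^m · det(D) · det( (H+L) − λ D^{-1} − λ^{-1} L ), where the determinants on the right are of the real matrices D, H, L, D^{-1} regarded as complex matrices. -/
open scoped Matrix

/-- Schur complement formula for a block matrix whose lower right block is a nonzero scalar. -/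
theorem det_fromBlocks_smul_one {K m n : Type*} [Field K] [Fintype m] [DecidableEq m]
    [Fintype n] [DecidableEq n] (A : Matrix m m K) (B : Matrix m n K) (C : Matrix n m K)
    {c : K} (hc : c ≠ 0) :
    (Matrix.fromBlocks A B C (c • (1 : Matrix n n K))).det
      = c ^ Fintype.card n * (A - c⁻¹ • (B * C)).det := by
  let _ : Invertible (c • (1 : Matrix n n K)) :=
    ⟨c⁻¹ • 1, by simp [smul_smul, hc], by simp [smul_smul, hc]⟩
  have hinv : ⅟(c • (1 : Matrix n n K)) = c⁻¹ • 1 := rfl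
  rw [Matrix.det_fromBlocks₂₂, hinv, Matrix.det_smul, Matrix.det_one, mul_one]
  simp

/-- The characteristic-polynomial factorization used in Lemma 2 of the paper:
for `λ ≠ 0`,
`det(M − λI) = (−λ)^m · det(D) · det((H+L) − λ D⁻¹ − λ⁻¹ L)`. -/
theorem block_matrix_charpoly_factorization
    (N m : ℕ) (hN : 0 < N) (hm : 0 < m)
    (D H L S : Matrix (Fin N) (Fin N) ℝ) (R : Matrix (Fin N) (Fin m) ℝ)
    (hD : IsUnit D.det) (hS : S.IsSymm)
    (hSR : S * R * Rᵀ * S = L)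
    (M : Matrix (Fin N ⊕ Fin m) (Fin N ⊕ Fin m) ℝ)
    (hM : M = Matrix.fromBlocks (D * (H + L)) (D * S * R) (-(Rᵀ * S)) 0)
    (lam : ℂ) (hlam : lam ≠ 0) :
    (M.map (Complex.ofReal)
        - lam • (1 : Matrix (Fin N ⊕ Fin m) (Fin N ⊕ Fin m) ℂ)).det
      = (-lam) ^ m * (D.map (Complex.ofReal)).det *
        ((H + L).map (Complex.ofReal) - lam • (D⁻¹.map (Complex.ofReal))
          - lam⁻¹ • (L.map (Complex.ofReal))).det := by
  have map_mul {a b c : ℕ} (X : Matrix (Fin a) (Fin b) ℝ) (Y : Matrix (Fin b) (Fin c) ℝ) :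
      (X * Y).map Complex.ofReal = X.map Complex.ofReal * Y.map Complex.ofReal :=
    Matrix.map_mul (f := Complex.ofRealHom)
  have hblocks : M.map Complex.ofReal - lam • (1 : Matrix (Fin N ⊕ Fin m) (Fin N ⊕ Fin m) ℂ)
      = Matrix.fromBlocks ((D * (H + L)).map Complex.ofReal - lam • 1)
          ((D * S * R).map Complex.ofReal) ((-(Rᵀ * S)).map Complex.ofReal)
          ((-lam) • (1 : Matrix (Fin m) (Fin m) ℂ)) := by
    rw [hM, Matrix.fromBlocks_map, ← Matrix.fromBlocks_one, Matrix.fromBlocks_smul,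
      sub_eq_add_neg, Matrix.fromBlocks_neg, Matrix.fromBlocks_add]
    simp [sub_eq_add_neg]
  have hprod : (D * S * R).map Complex.ofReal * (-(Rᵀ * S)).map Complex.ofReal
      = -(D.map Complex.ofReal * L.map Complex.ofReal) := by
    rw [← map_mul, ← map_mul, ← hSR, Matrix.mul_neg]
    ext i j
    simp [Matrix.mul_assoc]
  have hDinv : D.map Complex.ofReal * D⁻¹.map Complex.ofReal = 1 := by
    rw [← map_mul, Matrix.mul_nonsing_inv D hD]
    simp
  rw [hblocks, det_fromBlocks_smul_one _ _ _ (neg_ne_zero.mpr hlam), hprod, Fintype.card_fin,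
    mul_assoc, ← Matrix.det_mul, Matrix.mul_sub, Matrix.mul_sub, Matrix.mul_smul,
    Matrix.mul_smul, hDinv, map_mul]
  simp [inv_neg]
end

section
/- Let A, B ∈ ℝ^{N×N} be symmetric positive definite matrices and let C ∈ ℝ^{N×N} be symmetric positive semidefinite. Let λ ∈ ℂ with λ ≠ 0, and suppose the complex matrix A − λ B − λ^{-1} C is singular, i.e., det(A − λB − λ^{-1}C) = 0. Then Re λ > 0. -/
open scoped Matrix

/-- The Hermitian form of a real symmetric matrix at a complex vector is the sum of the values of
its quadratic form at the real and imaginary parts of the vector. -/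
theorem Matrix.IsHermitian.star_dotProduct_map_ofReal_mulVec {n : Type*} [Fintype n]
    {S : Matrix n n ℝ} (hS : S.IsHermitian) (v : n → ℂ) :
    star v ⬝ᵥ (S.map Complex.ofReal *ᵥ v) =
      (((fun i => (v i).re) ⬝ᵥ (S *ᵥ fun i => (v i).re) +
        (fun i => (v i).im) ⬝ᵥ (S *ᵥ fun i => (v i).im) : ℝ) : ℂ) := by
  have hsymm : ∑ i, ∑ j, (v i).re * (S i j * (v j).im) =
      ∑ i, ∑ j, (v i).im * (S i j * (v j).re) := by
    rw [Finset.sum_comm]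
    refine Finset.sum_congr rfl fun i _ => Finset.sum_congr rfl fun j _ => ?_
    have hij : S j i = S i j := by simpa using hS.apply i j
    rw [hij]
    ring
  apply Complex.ext
  · simp [dotProduct, Matrix.mulVec, Finset.mul_sum, ← Finset.sum_add_distrib]
  · simp [dotProduct, Matrix.mulVec, Finset.mul_sum, Finset.sum_add_distrib, hsymm]

/-- A positive semidefinite real matrix has a nonnegative Hermitian form. -/
theorem Matrix.PosSemidef.exists_star_dotProduct_map_ofReal_mulVec {n : Type*} [Fintype n]
    {S : Matrix n n ℝ} (hS : S.PosSemidef) (v : n → ℂ) :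
    ∃ s : ℝ, 0 ≤ s ∧ star v ⬝ᵥ (S.map Complex.ofReal *ᵥ v) = s :=
  ⟨_, add_nonneg (by simpa using hS.dotProduct_mulVec_nonneg fun i => (v i).re)
    (by simpa using hS.dotProduct_mulVec_nonneg fun i => (v i).im),
    hS.isHermitian.star_dotProduct_map_ofReal_mulVec v⟩

/-- A positive definite real matrix has a positive Hermitian form. -/
theorem Matrix.PosDef.exists_star_dotProduct_map_ofReal_mulVec {n : Type*} [Fintype n]
    {S : Matrix n n ℝ} (hS : S.PosDef) {v : n → ℂ} (hv : v ≠ 0) :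
    ∃ s : ℝ, 0 < s ∧ star v ⬝ᵥ (S.map Complex.ofReal *ᵥ v) = s := by
  refine ⟨_, ?_, hS.isHermitian.star_dotProduct_map_ofReal_mulVec v⟩
  by_cases hre : (fun i => (v i).re) = 0
  · have him : (fun i => (v i).im) ≠ 0 := fun him =>
      hv (funext fun i => Complex.ext (congrFun hre i) (congrFun him i))
    exact add_pos_of_nonneg_of_pos
      (by simpa using hS.posSemidef.dotProduct_mulVec_nonneg fun i => (v i).re)
      (by simpa using hS.dotProduct_mulVec_pos him)
  · exact add_pos_of_pos_of_nonneg (by simpa using hS.dotProduct_mulVec_pos hre)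
      (by simpa using hS.posSemidef.dotProduct_mulVec_nonneg fun i => (v i).im)

/-- If `A`, `B` are symmetric positive definite, `C` is symmetric positive
semidefinite, and the complex matrix `A − λB − λ⁻¹C` is singular for some
`λ ≠ 0`, then `Re λ > 0`. -/
theorem pencil_singular_re_pos
    (N : ℕ) (A B C : Matrix (Fin N) (Fin N) ℝ)
    (hA : A.PosDef) (hB : B.PosDef) (hC : C.PosSemidef)
    (lam : ℂ) (hlam : lam ≠ 0)
    (hdet : (A.map (Complex.ofReal) - lam • (B.map (Complex.ofReal))
        - lam⁻¹ • (C.map (Complex.ofReal))).det = 0) :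
    0 < lam.re := by
  obtain ⟨v, hv, hker⟩ := Matrix.exists_mulVec_eq_zero_iff.mpr hdet
  obtain ⟨a, ha, hav⟩ := hA.exists_star_dotProduct_map_ofReal_mulVec hv
  obtain ⟨b, hb, hbv⟩ := hB.exists_star_dotProduct_map_ofReal_mulVec hv
  obtain ⟨c, hc, hcv⟩ := hC.exists_star_dotProduct_map_ofReal_mulVec v
  have hform : (a : ℂ) - lam * b - lam⁻¹ * c = 0 := by
    have h := congrArg (star v ⬝ᵥ ·) hker
    simpa only [Matrix.sub_mulVec, Matrix.smul_mulVec, dotProduct_sub, dotProduct_smul,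
      dotProduct_zero, hav, hbv, hcv, smul_eq_mul] using h
  have hre : a = lam.re * (b + c / Complex.normSq lam) := by
    have h := congrArg Complex.re hform
    simp only [Complex.sub_re, Complex.re_mul_ofReal, Complex.ofReal_re, Complex.inv_re,
      Complex.zero_re] at h
    linear_combination h
  have hpos : 0 < b + c / Complex.normSq lam :=
    add_pos_of_pos_of_nonneg hb (div_nonneg hc (Complex.normSq_nonneg lam))
  exact pos_of_mul_pos_left (hre ▸ ha) hpos.le
end
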